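/- arXiv:2507.22552 — 3 statements merged into one kernel-verified Lean document; each statement's English description precedes it below -/
import Mathlib

section
/- (Mountain-pass geometry, part (i).) Assume (h1) and (f1)–(f3). Then there exist constants σ > 0 and ρ > 0 such that every u : ℤ^d → ℝ with ‖u‖_{H_{s,p}} = ρ satisfies J̃(u) ≥ σ. -/
open MeasureTheory Filter Topology
open scoped ENNReal

noncomputable section

namespace DiscreteChoquard

variable {d : ℕ}

/-- The lattice `ℤ^d`. -/
abbrev Z (d : ℕ) := Fin d → ℤ

/-- Graph distance on `ℤ^d`, as a real number. -/
def latDist (x y : Z d) : ℝ := ∑ i, |((x i - y i : ℤ) : ℝ)|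

/-- The kernel hypotheses on `W_s`: symmetry, positivity, and the two-sided bound
`c|x−y|^{−d−2s} ≤ W_s(x,y) ≤ C|x−y|^{−d−2s}` for `x ≠ y`. -/
def KernelOK (d : ℕ) (s : ℝ) (W : Z d → Z d → ℝ) : Prop :=
  (∀ x y, W x y = W y x) ∧ (∀ x y, 0 < W x y) ∧
  ∃ c C : ℝ, 0 < c ∧ c ≤ C ∧ ∀ x y : Z d, x ≠ y →
    c * latDist x y ^ (-(d : ℝ) - 2 * s) ≤ W x y ∧
      W x y ≤ C * latDist x y ^ (-(d : ℝ) - 2 * s)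

/-- The fractional gradient form `∇^s u ∇^s v (x)`.  (The `y = x` summand vanishes, so we
sum over all `y`.) -/
def gradForm (W : Z d → Z d → ℝ) (u v : Z d → ℝ) (x : Z d) : ℝ :=
  (1 / 2) * ∑' y : Z d, W x y * (u x - u y) * (v x - v y)

/-- `|∇^s u|(x)`. -/
def gradNorm (W : Z d → Z d → ℝ) (u : Z d → ℝ) (x : Z d) : ℝ :=
  Real.sqrt ((1 / 2) * ∑' y : Z d, W x y * (u x - u y) ^ 2)

/-- The fractional `p`-Laplacian `(−Δ)_p^s u (x)`. -/
def pLap (W : Z d → Z d → ℝ) (p : ℝ) (u : Z d → ℝ) (x : Z d) : ℝ :=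
  (1 / 2) * ∑' y : Z d,
    W x y * (gradNorm W u x ^ (p - 2) + gradNorm W u y ^ (p - 2)) * (u x - u y)

/-- `‖u‖_{H_{s,p}}^p = ∑_x (|∇^s u|^p(x) + h(x)|u(x)|^p)`. -/
def HnormP (W : Z d → Z d → ℝ) (h : Z d → ℝ) (p : ℝ) (u : Z d → ℝ) : ℝ :=
  ∑' x : Z d, (gradNorm W u x ^ p + h x * |u x| ^ p)

/-- `‖u‖_{H_{s,p}}`. -/
def normH (W : Z d → Z d → ℝ) (h : Z d → ℝ) (p : ℝ) (u : Z d → ℝ) : ℝ :=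
  HnormP W h p u ^ (1 / p)

/-- Membership `u ∈ H_{s,p}`, i.e. `‖u‖_{H_{s,p}} < ∞` (all the defining series converge). -/
def memH (W : Z d → Z d → ℝ) (h : Z d → ℝ) (p : ℝ) (u : Z d → ℝ) : Prop :=
  (∀ x : Z d, Summable fun y : Z d => W x y * (u x - u y) ^ 2) ∧
  Summable fun x : Z d => gradNorm W u x ^ p + h x * |u x| ^ p

/-- The `ℓ^q` norm on `ℤ^d`. -/
def lnorm (q : ℝ) (u : Z d → ℝ) : ℝ := (∑' x : Z d, |u x| ^ q) ^ (1 / q)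

/-- The torus box `[0, 2π]^d`. -/
def box (d : ℕ) : Set (Fin d → ℝ) := Set.univ.pi fun _ => Set.Icc 0 (2 * Real.pi)

/-- `μ(k) = 2d − 2 ∑_j cos k_j`. -/
def muk (d : ℕ) (k : Fin d → ℝ) : ℝ := 2 * d - 2 * ∑ j, Real.cos (k j)

/-- The fractional degree `K_α = (2π)^{-d} ∫_{[0,2π]^d} μ(k)^{α/2} dk`. -/
def Kfrac (d : ℕ) (α : ℝ) : ℝ :=
  (2 * Real.pi) ^ (-(d : ℝ)) * ∫ k in box d, muk d k ^ (α / 2)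

/-- The Green's function `R_α(x,y)` of the discrete fractional Laplacian. -/
def Riesz (d : ℕ) (α : ℝ) (x y : Z d) : ℝ :=
  Kfrac d α * (2 * Real.pi) ^ (-(d : ℝ)) *
    ∫ k in box d, Real.cos (∑ j, ((x j - y j : ℤ) : ℝ) * k j) * muk d k ^ (-(α / 2))

/-- The convolution `(R_α ∗ v)(x) = ∑_y R_α(x,y) v(y)`. -/
def conv (d : ℕ) (α : ℝ) (v : Z d → ℝ) (x : Z d) : ℝ := ∑' y : Z d, Riesz d α x y * v y

/-- `F(t) = ∫_0^t f(r) dr`. -/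
def Fint (f : ℝ → ℝ) (t : ℝ) : ℝ := ∫ r in (0 : ℝ)..t, f r

/-- Positive part `u⁺ = max(u,0)`. -/
def pos (u : Z d → ℝ) (x : Z d) : ℝ := max (u x) 0

/-- Negative part `u⁻ = min(u,0)`. -/
def negp (u : Z d → ℝ) (x : Z d) : ℝ := min (u x) 0

/-- Hypothesis (h2): `h(x) → ∞` as `|x| → ∞`. -/
def H2 (h : Z d → ℝ) : Prop := Tendsto h cofinite atTop

/-- Hypothesis (f1): `f(t) = o(t^{p−1})` as `t → 0⁺`. -/
def F1 (f : ℝ → ℝ) (p : ℝ) : Prop :=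
  ∀ ε > (0 : ℝ), ∃ δ > (0 : ℝ), ∀ t : ℝ, 0 < t → t < δ → |f t| ≤ ε * t ^ (p - 1)

/-- Hypothesis (f3): `0 ≤ θ F(t) ≤ 2 f(t) t` for `t > 0`. -/
def F3 (f : ℝ → ℝ) (θ : ℝ) : Prop :=
  ∀ t > (0 : ℝ), 0 ≤ θ * Fint f t ∧ θ * Fint f t ≤ 2 * f t * t

/-- The energy functional `J̃`. -/
def energy (W : Z d → Z d → ℝ) (h : Z d → ℝ) (p α : ℝ) (f : ℝ → ℝ) (u : Z d → ℝ) : ℝ :=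
  (1 / p) * HnormP W h p u -
    (1 / 2) * ∑' x : Z d, conv d α (fun y => Fint f (pos u y)) x * Fint f (pos u x)

/-- The Nehari set `M`. -/
def Nehari (W : Z d → Z d → ℝ) (h : Z d → ℝ) (p α : ℝ) (f : ℝ → ℝ) : Set (Z d → ℝ) :=
  {u | memH W h p u ∧ u ≠ 0 ∧
    HnormP W h p u =
      ∑' x : Z d, conv d α (fun y => Fint f (pos u y)) x * f (pos u x) * pos u x}

/-- Hypothesis (f4). -/
def F4 (W : Z d → Z d → ℝ) (h : Z d → ℝ) (p α : ℝ) (f : ℝ → ℝ) : Prop :=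
  ∀ u : Z d → ℝ, memH W h p u → pos u ≠ 0 →
    StrictMonoOn (fun t : ℝ =>
      t ^ (1 - p) *
        ∑' x : Z d, conv d α (fun y => Fint f (t * pos u y)) x * f (t * pos u x) * pos u x)
      (Set.Ioi 0)

/-- The derivative pairing `⟨J̃′(u), φ⟩`. -/
def pairing (W : Z d → Z d → ℝ) (h : Z d → ℝ) (p α : ℝ) (f : ℝ → ℝ) (u φ : Z d → ℝ) : ℝ :=
  (∑' x : Z d,
      (gradNorm W u x ^ (p - 2) * gradForm W u φ x + h x * |u x| ^ (p - 2) * u x * φ x)) -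
    ∑' x : Z d, conv d α (fun y => Fint f (pos u y)) x * f (pos u x) * φ x

lemma one_dim_integrable {β : ℝ} (hβ1 : β < 1) :
    Integrable (fun x : ℝ => (x / Real.pi) ^ (-β) + ((2 * Real.pi - x) / Real.pi) ^ (-β))
      (volume.restrict (Set.Ioo 0 (2 * Real.pi))) := by
  have hpi := Real.pi_pos
  have h1 : IntervalIntegrable (fun x : ℝ => x ^ (-β)) volume 0 2 :=
    intervalIntegral.intervalIntegrable_rpow' (by linarith)
  have h2 : IntervalIntegrable (fun x : ℝ => (x / Real.pi) ^ (-β)) volume 0 (2 * Real.pi) := by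
    have := h1.comp_mul_right (c := Real.pi⁻¹) 
    simpa [div_eq_mul_inv, hpi.ne'] using this
  have h3 : IntervalIntegrable (fun x : ℝ => ((2 * Real.pi - x) / Real.pi) ^ (-β)) volume 0
      (2 * Real.pi) := by
    have := (h2.comp_sub_left (2 * Real.pi)).symm
    simpa using this
  have h4 := h2.add h3
  rw [intervalIntegrable_iff_integrableOn_Ioo_of_le (by positivity)] at h4
  exact h4

lemma sin_half_bound {β : ℝ} (hβ : 0 < β) {x : ℝ} (hx : x ∈ Set.Ioo 0 (2 * Real.pi)) :
    0 < Real.sin (x / 2) ∧ Real.sin (x / 2) ^ (-β) ≤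
      (x / Real.pi) ^ (-β) + ((2 * Real.pi - x) / Real.pi) ^ (-β) := by
  have hpi := Real.pi_pos
  obtain ⟨h0, h1⟩ := hx
  refine ⟨Real.sin_pos_of_pos_of_lt_pi (by linarith) (by linarith), ?_⟩
  have a1 : 0 < x / Real.pi := by positivity
  have a2 : 0 < (2 * Real.pi - x) / Real.pi := div_pos (by linarith) hpi
  rcases le_total x Real.pi with hle | hle
  · have : x / Real.pi ≤ Real.sin (x / 2) := by
      have := Real.mul_le_sin (x := x / 2) (by linarith) (by linarith)
      calc x / Real.pi = 2 / Real.pi * (x / 2) := by ring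
        _ ≤ _ := this
    have h := Real.rpow_le_rpow_of_nonpos a1 this (by linarith : -β ≤ 0)
    have := Real.rpow_nonneg a2.le (-β)
    linarith
  · have : (2 * Real.pi - x) / Real.pi ≤ Real.sin (x / 2) := by
      have := Real.mul_le_sin (x := Real.pi - x / 2) (by linarith) (by linarith)
      rw [Real.sin_pi_sub] at this
      calc (2 * Real.pi - x) / Real.pi = 2 / Real.pi * (Real.pi - x / 2) := by ring
        _ ≤ _ := this
    have h := Real.rpow_le_rpow_of_nonpos a2 this (by linarith : -β ≤ 0)
    have := Real.rpow_nonneg a1.le (-β)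
    linarith

lemma muk_eq (d : ℕ) (k : Fin d → ℝ) : muk d k = ∑ j, 4 * Real.sin (k j / 2) ^ 2 := by
  have : ∀ j, 4 * Real.sin (k j / 2) ^ 2 = 2 - 2 * Real.cos (k j) := by
    intro j
    have h1 : Real.cos (k j) = 2 * Real.cos (k j / 2) ^ 2 - 1 := by
      rw [← Real.cos_two_mul]; ring_nf
    have h2 := Real.sin_sq_add_cos_sq (k j / 2)
    linarith
  simp only [this, muk, Finset.sum_sub_distrib, ← Finset.mul_sum]
  simp
  ring

lemma muk_bound {d : ℕ} (hd : 0 < d) {α : ℝ} (hα : 0 < α) {k : Fin d → ℝ}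
    (hk : ∀ j, k j ∈ Set.Ioo 0 (2 * Real.pi)) :
    muk d k ^ (-(α / 2)) ≤ ∏ j, ((k j / Real.pi) ^ (-(α / d)) +
      ((2 * Real.pi - k j) / Real.pi) ^ (-(α / d))) := by
  have hd' : (0 : ℝ) < d := by exact_mod_cast hd
  have hs : ∀ j, 0 < Real.sin (k j / 2) := fun j => (sin_half_bound one_pos (hk j)).1
  have amgm := Real.geom_mean_le_arith_mean_weighted Finset.univ (fun _ : Fin d => (1 / d : ℝ))
    (fun j => Real.sin (k j / 2) ^ 2) (fun _ _ => by positivity) (by simp [hd'.ne'])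
    (fun _ _ => by positivity)
  have hprod : 0 < ∏ j, (Real.sin (k j / 2) ^ 2) ^ (1 / d : ℝ) :=
    Finset.prod_pos fun j _ => Real.rpow_pos_of_pos (pow_pos (hs j) 2) _
  have hle : ∏ j, (Real.sin (k j / 2) ^ 2) ^ (1 / d : ℝ) ≤ muk d k := by
    refine amgm.trans ?_
    rw [muk_eq]
    refine Finset.sum_le_sum fun j _ => ?_
    have : (1 / d : ℝ) ≤ 1 := by
      rw [div_le_one hd']; exact_mod_cast hd
    nlinarith [sq_nonneg (Real.sin (k j / 2))]
  calc muk d k ^ (-(α / 2)) ≤ (∏ j, (Real.sin (k j / 2) ^ 2) ^ (1 / d : ℝ)) ^ (-(α / 2)) :=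
        Real.rpow_le_rpow_of_nonpos hprod hle (by linarith)
    _ = ∏ j, Real.sin (k j / 2) ^ (-(α / d)) := by
        rw [← Real.finsetProd_rpow _ _ (fun j _ => by positivity)]
        refine Finset.prod_congr rfl fun j _ => ?_
        rw [← Real.rpow_natCast, ← Real.rpow_mul (hs j).le, ← Real.rpow_mul (hs j).le]
        congr 1
        push_cast
        field_simp
    _ ≤ _ := Finset.prod_le_prod (fun j _ => Real.rpow_nonneg (hs j).le _)
        (fun j _ => (sin_half_bound (by positivity) (hk j)).2)

lemma muk_integrable {d : ℕ} (hd : 0 < d) {α : ℝ} (hα : α ∈ Set.Ioo (0 : ℝ) (d : ℝ)) :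
    IntegrableOn (fun k => muk d k ^ (-(α / 2))) (box d) := by
  have hd' : (0 : ℝ) < d := by exact_mod_cast hd
  have hbox : (Set.univ.pi fun _ : Fin d => Set.Ioo 0 (2 * Real.pi)) =ᵐ[volume] box d := by
    have := Measure.univ_pi_Ioo_ae_eq_Icc (μ := fun _ : Fin d => (volume : Measure ℝ))
      (f := fun _ => 0) (g := fun _ => 2 * Real.pi)
    rw [← Set.pi_univ_Icc] at this
    exact this
  rw [← integrableOn_congr_set_ae hbox]
  have hg : Integrable (fun k : Fin d → ℝ => ∏ j, ((k j / Real.pi) ^ (-(α / d)) +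
      ((2 * Real.pi - k j) / Real.pi) ^ (-(α / d))))
      (Measure.pi fun _ => volume.restrict (Set.Ioo 0 (2 * Real.pi))) :=
    Integrable.fintype_prod (f := fun _ x => (x / Real.pi) ^ (-(α / d)) +
      ((2 * Real.pi - x) / Real.pi) ^ (-(α / d)))
      (fun _ => one_dim_integrable ((div_lt_one hd').2 hα.2))
  rw [← Measure.restrict_pi_pi] at hg
  refine Integrable.mono' hg ?_ ?_
  · apply Measurable.aestronglyMeasurable
    unfold muk
    fun_prop
  · refine (ae_restrict_iff' (MeasurableSet.univ_pi fun _ => measurableSet_Ioo)).2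
      (Filter.Eventually.of_forall fun k hk => ?_)
    have hk' : ∀ j, k j ∈ Set.Ioo 0 (2 * Real.pi) := fun j => hk j (Set.mem_univ j)
    have hn : 0 ≤ muk d k := by
      rw [muk_eq]; exact Finset.sum_nonneg fun j _ => by positivity
    rw [Real.norm_of_nonneg (Real.rpow_nonneg hn _)]
    exact muk_bound hd hα.1 hk'

lemma riesz_bounded {d : ℕ} (hd : 0 < d) {α : ℝ} (hα : α ∈ Set.Ioo (0 : ℝ) (d : ℝ)) :
    ∃ M : ℝ, 0 ≤ M ∧ ∀ x y : Z d, |Riesz d α x y| ≤ M := by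
  refine ⟨|Kfrac d α * (2 * Real.pi) ^ (-(d : ℝ))| * ∫ k in box d, ‖muk d k ^ (-(α / 2))‖,
    mul_nonneg (abs_nonneg _) (integral_nonneg fun _ => norm_nonneg _), fun x y => ?_⟩
  unfold Riesz
  rw [abs_mul]
  refine mul_le_mul_of_nonneg_left ?_ (abs_nonneg _)
  rw [← Real.norm_eq_abs]
  refine norm_integral_le_of_norm_le (muk_integrable hd hα).norm
    (Filter.Eventually.of_forall fun k => ?_)
  rw [norm_mul]
  exact mul_le_of_le_one_left (norm_nonneg _) (Real.abs_cos_le_one _)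

lemma double_sum_bound {d : ℕ} {α M : ℝ} (hM : 0 ≤ M) (hR : ∀ x y : Z d, |Riesz d α x y| ≤ M)
    {v g : Z d → ℝ} (hg : Summable g) (hv : ∀ x, |v x| ≤ g x) :
    ∑' x : Z d, conv d α v x * v x ≤ M * (∑' x, g x) ^ 2 := by
  have hg0 : ∀ x, 0 ≤ g x := fun x => (abs_nonneg _).trans (hv x)
  have hS : 0 ≤ ∑' x, g x := tsum_nonneg hg0
  have hc : ∀ x, |conv d α v x| ≤ M * ∑' y, g y := by
    intro x
    rw [← Real.norm_eq_abs]
    refine tsum_of_norm_bounded (hg.hasSum.mul_left M) fun y => ?_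
    rw [norm_mul]
    exact mul_le_mul (hR x y) (hv y) (norm_nonneg _) hM
  have : ‖∑' x : Z d, conv d α v x * v x‖ ≤ (M * ∑' y, g y) * ∑' x, g x := by
    refine tsum_of_norm_bounded (hg.hasSum.mul_left _) fun x => ?_
    rw [norm_mul]
    exact mul_le_mul (hc x) (hv x) (norm_nonneg _) (mul_nonneg hM hS)
  calc _ ≤ _ := Real.le_norm_self _
    _ ≤ _ := this
    _ = _ := by ring

lemma Fint_bound {f : ℝ → ℝ} {p δ : ℝ} (hp : 2 ≤ p)
    (hδ : ∀ t : ℝ, 0 < t → t < δ → |f t| ≤ 1 * t ^ (p - 1)) {t : ℝ} (ht0 : |t| < δ) :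
    |Fint f (max t 0)| ≤ |t| ^ p := by
  rcases le_or_gt t 0 with h | h
  · rw [max_eq_right h]
    simp only [Fint, intervalIntegral.integral_same, abs_zero]
    positivity
  · rw [max_eq_left h.le]
    rw [abs_of_pos h] at ht0 ⊢
    have := intervalIntegral.norm_integral_le_of_norm_le_const (a := 0) (b := t) (f := f)
      (C := t ^ (p - 1)) (fun r hr => by
        rw [Set.uIoc_of_le h.le] at hr
        have := hδ r hr.1 (hr.2.trans_lt ht0)
        rw [one_mul] at this
        exact this.trans (Real.rpow_le_rpow hr.1.le hr.2 (by linarith)))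
    rw [sub_zero, abs_of_pos h, ← Real.rpow_add_one h.ne'] at this
    simpa [Fint] using this

theorem mountain_pass_geometry_i
    {d : ℕ} (hd : 0 < d) {s p : ℝ} (hs : s ∈ Set.Ioo (0 : ℝ) 1) (hp : 2 ≤ p)
    {W : Z d → Z d → ℝ} (hW : KernelOK d s W)
    {α : ℝ} (hα : α ∈ Set.Ioo (0 : ℝ) (d : ℝ))
    {h : Z d → ℝ} {h₀ : ℝ} (hh₀ : 0 < h₀) (hh1 : ∀ x, h₀ ≤ h x)
    {f : ℝ → ℝ} (hfc : Continuous f) (hfz : ∀ t ≤ (0 : ℝ), f t = 0)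
    (hf1 : F1 f p)
    {C₀ τ : ℝ} (hC₀ : 0 < C₀) (hτ : ((d : ℝ) + α) * p / (2 * d) < τ)
    (hf2 : ∀ t > (0 : ℝ), f t ≤ C₀ * (1 + t ^ (τ - 1)))
    {θ : ℝ} (hθ : p < θ) (hf3 : F3 f θ)
 :
    ∃ σ : ℝ, 0 < σ ∧ ∃ ρ : ℝ, 0 < ρ ∧
      ∀ u : Z d → ℝ, memH W h p u → normH W h p u = ρ → σ ≤ energy W h p α f u := by
  obtain ⟨M, hM, hR⟩ := riesz_bounded hd hα
  obtain ⟨δ, hδ0, hδ⟩ := hf1 1 one_pos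
  have hp0 : 0 < p := by linarith
  have hδp : 0 < δ ^ p := Real.rpow_pos_of_pos hδ0 p
  set A : ℝ := min (h₀ * δ ^ p / 2) (h₀ ^ 2 / (p * (M + 1))) with hA
  have hA0 : 0 < A := lt_min (by positivity) (by positivity)
  refine ⟨A / (2 * p), by positivity, A ^ (1 / p), Real.rpow_pos_of_pos hA0 _, ?_⟩
  intro u hu hn
  have hterm : ∀ x, h₀ * |u x| ^ p ≤ gradNorm W u x ^ p + h x * |u x| ^ p := by
    intro x
    have h1 : 0 ≤ gradNorm W u x ^ p := Real.rpow_nonneg (Real.sqrt_nonneg _) _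
    have h2 : 0 ≤ |u x| ^ p := Real.rpow_nonneg (abs_nonneg _) _
    nlinarith [mul_le_mul_of_nonneg_right (hh1 x) h2]
  have hnn : ∀ x, 0 ≤ h₀ * |u x| ^ p := fun x =>
    mul_nonneg hh₀.le (Real.rpow_nonneg (abs_nonneg _) _)
  have hH0 : 0 ≤ HnormP W h p u := tsum_nonneg fun x => (hnn x).trans (hterm x)
  have hHA : HnormP W h p u = A :=
    (Real.rpow_left_inj hH0 hA0.le (by positivity : (1 / p) ≠ 0)).1 hn
  have hsum1 : Summable fun x => h₀ * |u x| ^ p := Summable.of_nonneg_of_le hnn hterm hu.2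
  have hsum : Summable fun x => |u x| ^ p := (summable_mul_left_iff hh₀.ne').1 hsum1
  have htot : h₀ * ∑' x, |u x| ^ p ≤ A := by
    rw [← tsum_mul_left, ← hHA]
    exact hsum1.tsum_le_tsum hterm hu.2
  have hsmall : ∀ x, |u x| < δ := by
    intro x
    have h1 : |u x| ^ p ≤ ∑' x, |u x| ^ p :=
      hsum.le_tsum x fun y _ => Real.rpow_nonneg (abs_nonneg _) _
    have h2 : A ≤ h₀ * δ ^ p / 2 := min_le_left _ _
    have h3 : h₀ * |u x| ^ p < h₀ * δ ^ p := by
      have := mul_le_mul_of_nonneg_left h1 hh₀.le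
      have : 0 < h₀ * δ ^ p := by positivity
      linarith
    exact (Real.rpow_lt_rpow_iff (abs_nonneg _) hδ0.le hp0).1 (lt_of_mul_lt_mul_left h3 hh₀.le)
  have hD := double_sum_bound hM hR (v := fun x => Fint f (pos u x)) hsum
    (fun x => Fint_bound hp hδ (hsmall x))
  set S := ∑' x, |u x| ^ p with hS
  have hS0 : 0 ≤ S := tsum_nonneg fun y => Real.rpow_nonneg (abs_nonneg _) _
  have hMS : M * S ^ 2 ≤ A / p := by
    have h1 : S ≤ A / h₀ := by rw [le_div_iff₀ hh₀]; linarith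
    have h2 : A * (p * (M + 1)) ≤ h₀ ^ 2 := by
      rw [← le_div_iff₀ (by positivity)]; exact min_le_right _ _
    have h3 : (h₀ * S) ^ 2 ≤ A ^ 2 := pow_le_pow_left₀ (by positivity) htot 2
    rw [le_div_iff₀ hp0]
    have h4 : M * p * (h₀ * S) ^ 2 ≤ A * h₀ ^ 2 := by
      calc M * p * (h₀ * S) ^ 2 ≤ M * p * A ^ 2 := by gcongr
        _ ≤ A * (A * (p * (M + 1))) := by nlinarith [mul_pos hp0 (pow_pos hA0 2)]
        _ ≤ A * h₀ ^ 2 := by gcongr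
    have h5 : (M * S ^ 2 * p) * h₀ ^ 2 ≤ A * h₀ ^ 2 := by linarith
    exact le_of_mul_le_mul_right h5 (by positivity)
  unfold energy
  rw [hHA]
  have : A / (2 * p) = (1 / p) * A - (1 / 2) * (A / p) := by field_simp; ring
  rw [this]
  linarith

end DiscreteChoquard
end
end

section
/- (Palais–Smale condition.) Assume (h1), (h2) and (f1)–(f3). Let c ∈ ℝ and let (u_n) be a sequence in H_{s,p} such that J̃(u_n) → c and sup{ |⟨J̃′(u_n),φ⟩| : φ : ℤ^d → ℝ finitely supported with ‖φ‖_{H_{s,p}} ≤ 1 } → 0 as n → ∞. Then there exist a subsequence (u_{n_k}) and u ∈ H_{s,p} with ‖u_{n_k} − u‖_{H_{s,p}} → 0 as k → ∞. -/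
open MeasureTheory Filter Topology
open scoped ENNReal

noncomputable section

namespace DiscreteChoquard

variable {d : ℕ}

/-- one-dimensional weight -/
def wone (b : ℝ) (n : ℤ) : ℝ := if n = 0 then 1 else |(n : ℝ)| ^ (-b)

lemma wone_nonneg (b : ℝ) (n : ℤ) : 0 ≤ wone b n := by
  unfold wone; split_ifs <;> positivity

lemma wone_summable {b : ℝ} (hb : 1 < b) : Summable (wone b) := by
  have h1 := Real.summable_abs_int_rpow hb
  have h2 : Summable (fun n : ℤ => if n = 0 then (1 : ℝ) else 0) :=
    summable_of_ne_finset_zero (s := {0}) (by intro n hn; simp at hn; simp [hn])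
  refine Summable.of_nonneg_of_le (wone_nonneg b) ?_ (h1.add h2)
  intro n
  unfold wone
  split_ifs with h
  · have : 0 ≤ |(n : ℝ)| ^ (-b) := by positivity
    linarith
  · simp

lemma latDist_zero_right (z : Z d) : latDist z 0 = ∑ i, |((z i : ℤ) : ℝ)| := by
  simp [latDist]

lemma latSummable (hd : 0 < d) {s : ℝ} (hs : 0 < s) :
    Summable (fun z : Z d => if z = 0 then (0 : ℝ) else
      (latDist z 0) ^ (-(d : ℝ) - 2 * s)) := by
  have hd' : (0 : ℝ) < d := by exact_mod_cast hd
  set b : ℝ := 1 + 2 * s / d with hb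
  have hb1 : 1 < b := by rw [hb]; have : 0 < 2 * s / d := by positivity
                         linarith
  have hsum := wone_summable hb1
  have hprod : ∀ z : Z d, (if z = 0 then (0 : ℝ) else
      (latDist z 0) ^ (-(d : ℝ) - 2 * s)) ≤ ∏ i, wone b (z i) := by
    intro z
    split_ifs with hz
    · exact Finset.prod_nonneg fun i _ => wone_nonneg _ _
    · have hle : ∀ i, |(z i : ℝ)| ≤ latDist z 0 := by
        intro i
        rw [latDist_zero_right]
        exact Finset.single_le_sum (f := fun i => |(z i : ℝ)|) (fun j _ => abs_nonneg _)
          (Finset.mem_univ i)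
      have hone : 1 ≤ latDist z 0 := by
        obtain ⟨i, hi⟩ : ∃ i, z i ≠ 0 := by
          by_contra hcon
          push Not at hcon
          exact hz (funext hcon)
        refine le_trans ?_ (hle i)
        have : 1 ≤ |z i| := Int.one_le_abs hi
        exact_mod_cast this
      have hpos : 0 < latDist z 0 := by linarith
      have e : (latDist z 0) ^ (-(d : ℝ) - 2 * s) = ∏ i : Fin d, (latDist z 0) ^ (-b) := by
        rw [Finset.prod_const, Finset.card_univ, Fintype.card_fin, ← Real.rpow_natCast,
          ← Real.rpow_mul hpos.le]
        congr 1
        rw [hb]; field_simp; ring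
      rw [e]
      refine Finset.prod_le_prod (fun i _ => by positivity) fun i _ => ?_
      unfold wone
      split_ifs with h0
      · exact Real.rpow_le_one_of_one_le_of_nonpos hone (by linarith)
      · refine Real.rpow_le_rpow_of_nonpos (by simpa using h0) (hle i) (by linarith)
  have hnn : ∀ z : Z d, 0 ≤ (if z = 0 then (0 : ℝ) else
      (latDist z 0) ^ (-(d : ℝ) - 2 * s)) := by
    intro z; split_ifs
    · exact le_rfl
    · apply Real.rpow_nonneg; unfold latDist; positivity
  refine summable_of_sum_le (c := ∏ _i : Fin d, ∑' n, wone b n) hnn ?_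
  intro S
  refine (Finset.sum_le_sum fun z _ => hprod z).trans ?_
  classical
  calc ∑ z ∈ S, ∏ i, wone b (z i)
      ≤ ∑ z ∈ Fintype.piFinset (fun i => S.image (fun z => z i)), ∏ i, wone b (z i) := by
        refine Finset.sum_le_sum_of_subset_of_nonneg ?_
          (fun z _ _ => Finset.prod_nonneg fun i _ => wone_nonneg _ _)
        intro z hz
        rw [Fintype.mem_piFinset]
        intro i
        exact Finset.mem_image_of_mem _ hz
    _ = ∏ i, ∑ n ∈ S.image (fun z => z i), wone b n := by
        rw [Finset.prod_univ_sum]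
    _ ≤ _ := by
        refine Finset.prod_le_prod (fun i _ => Finset.sum_nonneg fun n _ => wone_nonneg _ _) ?_
        intro i _
        exact hsum.sum_le_tsum _ fun n _ => wone_nonneg _ _

/-- off-diagonal kernel -/
def Wo (W : Z d → Z d → ℝ) (x y : Z d) : ℝ := open Classical in if x = y then 0 else W x y

lemma kernel_bound (hd : 0 < d) {s : ℝ} (hs : 0 < s) {W : Z d → Z d → ℝ}
    (hW : KernelOK d s W) :
    (∀ x y, 0 ≤ Wo W x y) ∧ (∀ x y, Wo W x y = Wo W y x) ∧
    ∃ K : ℝ, 0 < K ∧ ∀ x, Summable (Wo W x) ∧ ∑' y, Wo W x y ≤ K := by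
  obtain ⟨hsym, hpos, c, C, hc, hcC, hb⟩ := hW
  have h0 : ∀ x y, 0 ≤ Wo W x y := by
    intro x y; unfold Wo; split_ifs
    · exact le_rfl
    · exact (hpos x y).le
  refine ⟨h0, ?_, ?_⟩
  · intro x y
    unfold Wo
    by_cases h : x = y
    · simp [h]
    · simp [h, Ne.symm h, hsym x y]
  · set g : Z d → ℝ := fun z => if z = 0 then (0 : ℝ) else
      (latDist z 0) ^ (-(d : ℝ) - 2 * s) with hg
    have hgs : Summable g := latSummable hd hs
    have hgn : ∀ z, 0 ≤ g z := by
      intro z; simp only [hg]; split_ifs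
      · exact le_rfl
      · apply Real.rpow_nonneg; unfold latDist; positivity
    have hCp : 0 < C := by linarith
    have hg0 : 0 ≤ ∑' z, g z := tsum_nonneg hgn
    refine ⟨C * ∑' z, g z + 1, by positivity, ?_⟩
    intro x
    have hle : ∀ y, Wo W x y ≤ C * g (x - y) := by
      intro y
      unfold Wo
      split_ifs with h
      · have := hgn (x - y); positivity
      · have h2 : x - y ≠ 0 := sub_ne_zero.mpr h
        have := (hb x y h).2
        simp only [hg, h2, if_false]
        convert this using 3
        simp [latDist]
    have hs' : Summable (fun y => C * g (x - y)) :=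
      (((Equiv.subLeft x).summable_iff).mpr hgs).mul_left C
    have hS : Summable (Wo W x) := Summable.of_nonneg_of_le (h0 x) hle hs'
    refine ⟨hS, ?_⟩
    have h3 := hS.tsum_le_tsum hle hs'
    rw [tsum_mul_left] at h3
    have h4 : ∑' y, g (x - y) = ∑' z, g z := (Equiv.subLeft x).tsum_eq g
    rw [h4] at h3
    linarith

lemma jensen_tsum {ι : Type*} {w a : ι → ℝ} {K q : ℝ} (hq : 1 ≤ q) (hK : 0 < K)
    (hw : ∀ i, 0 ≤ w i) (ha : ∀ i, 0 ≤ a i) (hws : Summable w) (hwK : ∑' i, w i ≤ K)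
    (hs : Summable fun i => w i * a i ^ q) :
    (Summable fun i => w i * a i) ∧
      (∑' i, w i * a i) ^ q ≤ K ^ (q - 1) * ∑' i, w i * a i ^ q := by
  have hn : ∀ i, 0 ≤ w i * a i ^ q := fun i => mul_nonneg (hw i) (Real.rpow_nonneg (ha i) _)
  have hn1 : ∀ i, 0 ≤ w i * a i := fun i => mul_nonneg (hw i) (ha i)
  have hq0 : 0 < q := by linarith
  set T := ∑' i, w i * a i ^ q with hT
  have hT0 : 0 ≤ T := tsum_nonneg hn
  have hqi : q⁻¹ ≤ 1 := inv_le_one_of_one_le₀ hq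
  have hfin : ∀ S : Finset ι, ∑ i ∈ S, w i * a i ≤ K ^ (1 - q⁻¹) * T ^ q⁻¹ := by
    intro S
    refine (Real.inner_le_weight_mul_Lp_of_nonneg S hq w a hw ha).trans ?_
    have h1 : ∑ i ∈ S, w i ≤ K := (hws.sum_le_tsum S fun i _ => hw i).trans hwK
    have h2 : ∑ i ∈ S, w i * a i ^ q ≤ T := hs.sum_le_tsum S fun i _ => hn i
    have h3 : 0 ≤ ∑ i ∈ S, w i := Finset.sum_nonneg fun i _ => hw i
    have h4 : 0 ≤ ∑ i ∈ S, w i * a i ^ q := Finset.sum_nonneg fun i _ => hn i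
    gcongr
  have hS := summable_of_sum_le hn1 hfin
  refine ⟨hS, ?_⟩
  have h5 : ∑' i, w i * a i ≤ K ^ (1 - q⁻¹) * T ^ q⁻¹ := hS.tsum_le_of_sum_le hfin
  have h6 : 0 ≤ ∑' i, w i * a i := tsum_nonneg hn1
  calc (∑' i, w i * a i) ^ q ≤ (K ^ (1 - q⁻¹) * T ^ q⁻¹) ^ q := by gcongr
    _ = K ^ (q - 1) * T := by
      rw [Real.mul_rpow (by positivity) (by positivity), ← Real.rpow_mul hK.le,
        ← Real.rpow_mul hT0, inv_mul_cancel₀ hq0.ne', Real.rpow_one]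
      congr 2
      field_simp

lemma abs_sub_rpow_le {p : ℝ} (hp : 0 ≤ p) (a b : ℝ) :
    |a - b| ^ p ≤ 2 ^ p * (|a| ^ p + |b| ^ p) := by
  have h1 : |a - b| ≤ 2 * max |a| |b| := by
    have := abs_sub a b
    have h1 := le_max_left |a| |b|
    have h2 := le_max_right |a| |b|
    linarith
  have h2 : (max |a| |b|) ^ p ≤ |a| ^ p + |b| ^ p := by
    have ha : 0 ≤ |a| ^ p := by positivity
    have hb : 0 ≤ |b| ^ p := by positivity
    rcases max_choice |a| |b| with h | h <;> rw [h] <;> linarith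
  calc |a - b| ^ p ≤ (2 * max |a| |b|) ^ p := by gcongr
    _ = 2 ^ p * (max |a| |b|) ^ p := Real.mul_rpow (by norm_num) (le_max_of_le_left (abs_nonneg a))
    _ ≤ _ := by gcongr

lemma holder_pm1 {ι : Type*} {a b : ι → ℝ} {p : ℝ} (hp : 2 ≤ p)
    (ha : ∀ i, 0 ≤ a i) (hb : ∀ i, 0 ≤ b i)
    (hsa : Summable fun i => a i ^ p) (hsb : Summable fun i => b i ^ p) :
    (Summable fun i => a i ^ (p - 1) * b i) ∧
      ∑' i, a i ^ (p - 1) * b i ≤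
        (∑' i, a i ^ p) ^ ((p - 1) / p) * (∑' i, b i ^ p) ^ (1 / p) := by
  have hc : (p / (p - 1)).HolderConjugate p :=
    (Real.HolderConjugate.conjExponent (by linarith : 1 < p)).symm
  have e : ∀ i, (a i ^ (p - 1)) ^ (p / (p - 1)) = a i ^ p := by
    intro i
    rw [← Real.rpow_mul (ha i)]
    congr 1
    have : p - 1 ≠ 0 := by linarith
    field_simp
  have := Real.summable_and_inner_le_Lp_mul_Lq_tsum_of_nonneg hc
    (f := fun i => a i ^ (p - 1)) (g := b) (fun i => Real.rpow_nonneg (ha i) _) hb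
    (by simpa only [e] using hsa) hsb
  simpa only [e, one_div_div] using this

/-- the kernel facts -/
structure KB (W : Z d → Z d → ℝ) (K : ℝ) : Prop where
  nn : ∀ x y, 0 ≤ Wo W x y
  sym : ∀ x y, Wo W x y = Wo W y x
  pos : 0 < K
  summ : ∀ x, Summable (Wo W x)
  le : ∀ x, ∑' y, Wo W x y ≤ K

lemma Wo_mul_sq (W : Z d → Z d → ℝ) (u : Z d → ℝ) (x y : Z d) :
    W x y * (u x - u y) ^ 2 = Wo W x y * (u x - u y) ^ 2 := by
  unfold Wo; split_ifs with h
  · simp [h]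
  · rfl

lemma Wo_mul_form (W : Z d → Z d → ℝ) (u v : Z d → ℝ) (x y : Z d) :
    W x y * (u x - u y) * (v x - v y) = Wo W x y * (u x - u y) * (v x - v y) := by
  unfold Wo; split_ifs with h
  · simp [h]
  · rfl

lemma Wo_sq_fun (W : Z d → Z d → ℝ) (u : Z d → ℝ) (x : Z d) :
    (fun y => W x y * (u x - u y) ^ 2) = fun y => Wo W x y * (u x - u y) ^ 2 :=
  funext fun y => Wo_mul_sq W u x y

lemma Wo_form_fun (W : Z d → Z d → ℝ) (u v : Z d → ℝ) (x : Z d) :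
    (fun y => W x y * (u x - u y) * (v x - v y)) =
      fun y => Wo W x y * (u x - u y) * (v x - v y) :=
  funext fun y => Wo_mul_form W u v x y

lemma gradNorm_nonneg (W : Z d → Z d → ℝ) (u : Z d → ℝ) (x : Z d) : 0 ≤ gradNorm W u x :=
  Real.sqrt_nonneg _

lemma term_le_tsum {ι : Type*} {a : ι → ℝ} (ha : ∀ i, 0 ≤ a i) (hs : Summable a) (i : ι) :
    a i ≤ ∑' j, a j := hs.le_tsum i fun j _ => ha j

lemma double_sums {W : Z d → Z d → ℝ} {K : ℝ} (hK : KB W K) (g : Z d → ℝ)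
    (hn : ∀ x, 0 ≤ g x) (hu : Summable g) :
    (Summable (fun z : Z d × Z d => Wo W z.1 z.2 * g z.1)) ∧
    (Summable (fun z : Z d × Z d => Wo W z.1 z.2 * g z.2)) ∧
    (∑' z : Z d × Z d, Wo W z.1 z.2 * g z.1 ≤ K * ∑' x, g x) ∧
    (∑' z : Z d × Z d, Wo W z.1 z.2 * g z.2 ≤ K * ∑' x, g x) := by
  have hrow : ∀ x, Summable fun y => Wo W x y * g x := fun x => (hK.summ x).mul_right (g x)
  have hrowle : ∀ x, ∑' y, Wo W x y * g x ≤ K * g x := by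
    intro x
    rw [tsum_mul_right]
    exact mul_le_mul_of_nonneg_right (hK.le x) (hn x)
  have hrows : Summable fun x => ∑' y, Wo W x y * g x :=
    Summable.of_nonneg_of_le (fun x => tsum_nonneg fun y => mul_nonneg (hK.nn x y) (hn x))
      hrowle (hu.mul_left K)
  have hS1 : Summable (fun z : Z d × Z d => Wo W z.1 z.2 * g z.1) := by
    have hnn : (0 : Z d × Z d → ℝ) ≤ fun z : Z d × Z d => Wo W z.1 z.2 * g z.1 :=
      fun z => mul_nonneg (hK.nn z.1 z.2) (hn z.1)
    exact (summable_prod_of_nonneg hnn).mpr ⟨hrow, hrows⟩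
  have hS2 : Summable (fun z : Z d × Z d => Wo W z.1 z.2 * g z.2) := by
    have := hS1.prod_symm
    refine this.congr ?_
    intro z
    simp only [Prod.fst_swap, Prod.snd_swap]
    rw [hK.sym]
  have hT1 : ∑' z : Z d × Z d, Wo W z.1 z.2 * g z.1 ≤ K * ∑' x, g x := by
    rw [hS1.tsum_prod, ← tsum_mul_left]
    exact Summable.tsum_le_tsum hrowle hrows (hu.mul_left K)
  refine ⟨hS1, hS2, hT1, ?_⟩
  rw [← (Equiv.prodComm _ _).tsum_eq]
  refine le_trans (le_of_eq ?_) hT1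
  refine tsum_congr fun z => ?_
  simp only [Equiv.prodComm_apply, Prod.fst_swap, Prod.snd_swap]
  rw [hK.sym]

lemma gradP_bound {W : Z d → Z d → ℝ} {K p : ℝ} (hK : KB W K) (hp : 2 ≤ p) :
    ∃ CG : ℝ, 0 < CG ∧ ∀ u : Z d → ℝ, (Summable fun x => |u x| ^ p) →
      (∀ x, Summable fun y => W x y * (u x - u y) ^ 2) ∧
      (Summable fun x => gradNorm W u x ^ p) ∧
      ∑' x, gradNorm W u x ^ p ≤ CG * ∑' x, |u x| ^ p := by
  have hKp := hK.pos
  refine ⟨K ^ (p / 2 - 1) * (2 ^ p * (2 * K)), by positivity, ?_⟩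
  intro u hu
  have hn : ∀ x, 0 ≤ |u x| ^ p := fun x => by positivity
  set U := ∑' x, |u x| ^ p with hU
  have hU0 : 0 ≤ U := tsum_nonneg hn
  have hleU : ∀ x, |u x| ^ p ≤ U := term_le_tsum hn hu
  obtain ⟨hS1, hS2, hT1, hT2⟩ := double_sums hK (fun x => |u x| ^ p) hn hu
  rw [← hU] at hT1 hT2
  have hS := hS1.add hS2
  have e : ∀ x y, ((u x - u y) ^ 2) ^ (p / 2) = |u x - u y| ^ p := by
    intro x y
    rw [← sq_abs, ← Real.rpow_natCast, ← Real.rpow_mul (abs_nonneg _)]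
    congr 1; push_cast; ring
  have hin : ∀ x y, Wo W x y * ((u x - u y) ^ 2) ^ (p / 2) ≤
      2 ^ p * (Wo W x y * |u x| ^ p + Wo W x y * |u y| ^ p) := by
    intro x y
    rw [e]
    calc Wo W x y * |u x - u y| ^ p ≤ Wo W x y * (2 ^ p * (|u x| ^ p + |u y| ^ p)) :=
          mul_le_mul_of_nonneg_left (abs_sub_rpow_le (by linarith) _ _) (hK.nn _ _)
      _ = _ := by ring
  have hrow : ∀ x, Summable fun y => Wo W x y * |u x| ^ p + Wo W x y * |u y| ^ p :=
    fun x => hS.prod_factor x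
  have hrow' : ∀ x, Summable fun y => Wo W x y * ((u x - u y) ^ 2) ^ (p / 2) := fun x =>
    Summable.of_nonneg_of_le (fun y => mul_nonneg (hK.nn _ _) (by positivity)) (hin x)
      ((hrow x).mul_left _)
  have hJ := fun x => jensen_tsum (q := p / 2) (by linarith) hKp (hK.nn x)
    (fun y => sq_nonneg (u x - u y)) (hK.summ x) (hK.le x) (hrow' x)
  have hpt : ∀ x, gradNorm W u x ^ p ≤ K ^ (p / 2 - 1) * (2 ^ p *
      ∑' y, (Wo W x y * |u x| ^ p + Wo W x y * |u y| ^ p)) := by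
    intro x
    have h1 := (hJ x).2
    have h0 : 0 ≤ ∑' y, Wo W x y * (u x - u y) ^ 2 :=
      tsum_nonneg fun y => mul_nonneg (hK.nn _ _) (sq_nonneg _)
    have h2 : gradNorm W u x ^ p ≤ (∑' y, Wo W x y * (u x - u y) ^ 2) ^ (p / 2) := by
      unfold gradNorm
      rw [Wo_sq_fun]
      rw [Real.sqrt_eq_rpow, ← Real.rpow_mul (by positivity)]
      rw [show 1 / 2 * p = p / 2 by ring]
      gcongr
      linarith
    refine h2.trans (h1.trans ?_)
    gcongr
    rw [← tsum_mul_left]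
    exact (hrow' x).tsum_le_tsum (hin x) ((hrow x).mul_left _)
  have hsumm : Summable fun x => K ^ (p / 2 - 1) * (2 ^ p *
      ∑' y, (Wo W x y * |u x| ^ p + Wo W x y * |u y| ^ p)) := (hS.prod.mul_left _).mul_left _
  have hG : Summable fun x => gradNorm W u x ^ p :=
    Summable.of_nonneg_of_le (fun x => Real.rpow_nonneg (gradNorm_nonneg _ _ _) _) hpt hsumm
  refine ⟨fun x => ?_, hG, ?_⟩
  · rw [Wo_sq_fun]; exact (hJ x).1
  · refine (hG.tsum_le_tsum hpt hsumm).trans ?_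
    rw [tsum_mul_left, tsum_mul_left, ← hS.tsum_prod, hS1.tsum_add hS2]
    have : ∑' z : Z d × Z d, Wo W z.1 z.2 * |u z.1| ^ p +
      ∑' z : Z d × Z d, Wo W z.1 z.2 * |u z.2| ^ p ≤ 2 * K * U := by linarith
    calc _ ≤ K ^ (p / 2 - 1) * (2 ^ p * (2 * K * U)) := by gcongr
      _ = _ := by ring

lemma gradNorm_sq {W : Z d → Z d → ℝ} {K : ℝ} (hK : KB W K) (u : Z d → ℝ) (x : Z d) :
    gradNorm W u x ^ 2 = (1 / 2) * ∑' y, Wo W x y * (u x - u y) ^ 2 := by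
  unfold gradNorm
  rw [Wo_sq_fun]
  rw [Real.sq_sqrt]
  have h0 : 0 ≤ ∑' y, Wo W x y * (u x - u y) ^ 2 :=
      tsum_nonneg fun y => mul_nonneg (hK.nn _ _) (sq_nonneg _)
  positivity

lemma gradForm_self {W : Z d → Z d → ℝ} {K : ℝ} (hK : KB W K) (u : Z d → ℝ) (x : Z d) :
    gradForm W u u x = gradNorm W u x ^ 2 := by
  rw [gradNorm_sq hK]
  unfold gradForm
  rw [Wo_form_fun]
  congr 1
  refine tsum_congr fun y => by ring

lemma gradForm_cs {W : Z d → Z d → ℝ} {K : ℝ} (hK : KB W K) (u v : Z d → ℝ) (x : Z d)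
    (hu : Summable fun y => W x y * (u x - u y) ^ 2)
    (hv : Summable fun y => W x y * (v x - v y) ^ 2) :
    (Summable fun y => W x y * (u x - u y) * (v x - v y)) ∧
    |gradForm W u v x| ≤ gradNorm W u x * gradNorm W v x := by
  rw [Wo_sq_fun] at hu hv
  have hc : (2 : ℝ).HolderConjugate 2 := Real.HolderConjugate.two_two
  have e : ∀ (u : Z d → ℝ) (y : Z d), (√(Wo W x y) * |u x - u y|) ^ (2 : ℝ)
      = Wo W x y * (u x - u y) ^ 2 := by
    intro u y
    rw [Real.rpow_two, mul_pow, Real.sq_sqrt (hK.nn _ _), sq_abs]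
  have H := Real.summable_and_inner_le_Lp_mul_Lq_tsum_of_nonneg hc
    (f := fun y => √(Wo W x y) * |u x - u y|) (g := fun y => √(Wo W x y) * |v x - v y|)
    (fun y => by positivity) (fun y => by positivity)
    (by simpa only [e] using hu) (by simpa only [e] using hv)
  simp only [e] at H
  have e2 : ∀ y, √(Wo W x y) * |u x - u y| * (√(Wo W x y) * |v x - v y|)
      = |W x y * (u x - u y) * (v x - v y)| := by
    intro y
    rw [Wo_mul_form, abs_mul, abs_mul, abs_of_nonneg (hK.nn x y)]
    nth_rewrite 3 [← Real.mul_self_sqrt (hK.nn x y)]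
    ring
  simp only [e2] at H
  have hs : Summable fun y => W x y * (u x - u y) * (v x - v y) := H.1.of_abs
  refine ⟨hs, ?_⟩
  have h1 : |∑' y, W x y * (u x - u y) * (v x - v y)| ≤
      ∑' y, |W x y * (u x - u y) * (v x - v y)| := by
    simpa using norm_tsum_le_tsum_norm (f := fun y => W x y * (u x - u y) * (v x - v y))
      (by simpa using H.1)
  have hu0 : 0 ≤ ∑' y, Wo W x y * (u x - u y) ^ 2 :=
      tsum_nonneg fun y => mul_nonneg (hK.nn _ _) (sq_nonneg _)
  have hv0 : 0 ≤ ∑' y, Wo W x y * (v x - v y) ^ 2 :=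
      tsum_nonneg fun y => mul_nonneg (hK.nn _ _) (sq_nonneg _)
  have h2 := h1.trans H.2
  unfold gradForm gradNorm
  rw [Wo_sq_fun W u, Wo_sq_fun W v]
  rw [abs_mul, abs_of_pos (by norm_num : (0:ℝ) < 1 / 2),
    Real.sqrt_mul (by norm_num), Real.sqrt_mul (by norm_num)]
  have h3 : √(1 / 2 : ℝ) * √(1 / 2) = 1 / 2 := Real.mul_self_sqrt (by norm_num)
  rw [← Real.sqrt_eq_rpow, ← Real.sqrt_eq_rpow] at h2
  calc _ ≤ 1 / 2 * (√(∑' y, Wo W x y * (u x - u y) ^ 2) * √(∑' y, Wo W x y * (v x - v y) ^ 2)) := by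
        gcongr
    _ = (√(1 / 2 : ℝ) * √(1 / 2)) * (√(∑' y, Wo W x y * (u x - u y) ^ 2) *
          √(∑' y, Wo W x y * (v x - v y) ^ 2)) := by rw [h3]
    _ = _ := by ring

/-- gradient pairing -/
def gT (W : Z d → Z d → ℝ) (p : ℝ) (u φ : Z d → ℝ) : ℝ :=
  ∑' x, gradNorm W u x ^ (p - 2) * gradForm W u φ x

lemma gT_bound {W : Z d → Z d → ℝ} {K p : ℝ} (hK : KB W K) (hp : 2 ≤ p) :
    ∃ CG : ℝ, 0 < CG ∧ ∀ u φ : Z d → ℝ, (Summable fun x => |u x| ^ p) →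
      (Summable fun x => |φ x| ^ p) →
      (Summable fun x => gradNorm W u x ^ (p - 2) * gradForm W u φ x) ∧
      |gT W p u φ| ≤ CG * (∑' x, |u x| ^ p) ^ ((p - 1) / p) * (∑' x, |φ x| ^ p) ^ (1 / p) := by
  obtain ⟨C, hC, H⟩ := gradP_bound hK hp
  refine ⟨C ^ ((p - 1) / p) * C ^ (1 / p), by positivity, ?_⟩
  intro u φ hu hφ
  obtain ⟨hu1, hu2, hu3⟩ := H u hu
  obtain ⟨hφ1, hφ2, hφ3⟩ := H φ hφ
  have hh := holder_pm1 hp (gradNorm_nonneg W u) (gradNorm_nonneg W φ) hu2 hφ2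
  have hle : ∀ x, ‖gradNorm W u x ^ (p - 2) * gradForm W u φ x‖ ≤
      gradNorm W u x ^ (p - 1) * gradNorm W φ x := by
    intro x
    have h0 := gradNorm_nonneg W u x
    rw [Real.norm_eq_abs, abs_mul, abs_of_nonneg (Real.rpow_nonneg h0 _)]
    have e : gradNorm W u x ^ (p - 1) = gradNorm W u x ^ (p - 2) * gradNorm W u x := by
      rw [← Real.rpow_add_one' h0 (by linarith)]
      congr 1; ring
    rw [e, mul_assoc]
    exact mul_le_mul_of_nonneg_left (gradForm_cs hK u φ x (hu1 x) (hφ1 x)).2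
      (Real.rpow_nonneg h0 _)
  have hs := Summable.of_norm_bounded hh.1 hle
  refine ⟨hs, ?_⟩
  have h1 : |gT W p u φ| ≤ ∑' x, gradNorm W u x ^ (p - 1) * gradNorm W φ x :=
    tsum_of_norm_bounded hh.1.hasSum hle
  have hnn : ∀ v : Z d → ℝ, 0 ≤ ∑' x, gradNorm W v x ^ p := fun v =>
    tsum_nonneg fun x => Real.rpow_nonneg (gradNorm_nonneg _ _ _) _
  have hnu : ∀ v : Z d → ℝ, 0 ≤ ∑' x, |v x| ^ p := fun v =>
    tsum_nonneg fun x => by positivity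
  have hp1 : 0 ≤ (p - 1) / p := div_nonneg (by linarith) (by linarith)
  have hp2 : 0 ≤ 1 / p := by positivity
  calc _ ≤ _ := h1
    _ ≤ _ := hh.2
    _ ≤ (C * ∑' x, |u x| ^ p) ^ ((p - 1) / p) * (C * ∑' x, |φ x| ^ p) ^ (1 / p) := by
      have := hnn u
      have := hnn φ
      have := hnu u
      have := hnu φ
      gcongr
    _ = _ := by
      rw [Real.mul_rpow hC.le (hnu u), Real.mul_rpow hC.le (hnu φ)]; ring

lemma box_measure (d : ℕ) : (volume : Measure (Fin d → ℝ)).restrict (box d) =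
    Measure.pi (fun _ : Fin d => (volume : Measure ℝ).restrict (Set.Icc 0 (2 * Real.pi))) := by
  unfold box
  exact Measure.restrict_pi_pi (μ := fun _ : Fin d => (volume : Measure ℝ))
    (fun _ => Set.Icc 0 (2 * Real.pi))

lemma box_measurable (d : ℕ) : MeasurableSet (box d) :=
  MeasurableSet.univ_pi fun _ => measurableSet_Icc

lemma muk_ge (k : Fin d → ℝ) (j : Fin d) : 2 - 2 * Real.cos (k j) ≤ muk d k := by
  have h : muk d k = ∑ i, (2 - 2 * Real.cos (k i)) := by
    unfold muk
    rw [Finset.sum_sub_distrib, Finset.mul_sum]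
    simp [mul_comm]
  rw [h]
  exact Finset.single_le_sum (f := fun i => 2 - 2 * Real.cos (k i))
    (fun i _ => by have := Real.cos_le_one (k i); linarith) (Finset.mem_univ j)

lemma muk_nonneg (k : Fin d → ℝ) : 0 ≤ muk d k := by
  unfold muk
  have : ∑ j, Real.cos (k j) ≤ ∑ _j : Fin d, (1 : ℝ) :=
    Finset.sum_le_sum fun j _ => Real.cos_le_one _
  simp at this
  linarith

lemma ae_box (d : ℕ) : ∀ᵐ k ∂(volume : Measure (Fin d → ℝ)).restrict (box d),
    ∀ j, 0 < k j ∧ k j < 2 * Real.pi := by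
  rw [ae_all_iff]
  intro j
  have h1 : ∀ᵐ k : Fin d → ℝ, k j ≠ 0 :=
    Measure.ae_eval_ne (μ := fun _ : Fin d => (volume : Measure ℝ)) j 0
  have h2 : ∀ᵐ k : Fin d → ℝ, k j ≠ 2 * Real.pi :=
    Measure.ae_eval_ne (μ := fun _ : Fin d => (volume : Measure ℝ)) j _
  filter_upwards [ae_restrict_mem (box_measurable d), ae_restrict_of_ae h1,
    ae_restrict_of_ae h2] with k hk h1 h2
  have := hk j (Set.mem_univ j)
  exact ⟨lt_of_le_of_ne this.1 (Ne.symm h1), lt_of_le_of_ne this.2 h2⟩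

lemma one_sub_cos_lower {t : ℝ} (h0 : 0 < t) (h1 : t < 2 * Real.pi) :
    (2 / Real.pi * min t (2 * Real.pi - t)) ^ 2 ≤ 2 - 2 * Real.cos t := by
  have hpi := Real.pi_pos
  have e : 2 - 2 * Real.cos t = (2 * Real.sin (t / 2)) ^ 2 := by
    have := Real.cos_sq' (t / 2)
    have h2 := Real.cos_two_mul (t / 2)
    rw [show 2 * (t / 2) = t by ring] at h2
    rw [h2, this]; ring
  rw [e]
  have hm : 0 ≤ min t (2 * Real.pi - t) := le_min h0.le (by linarith)
  refine pow_le_pow_left₀ (by positivity) ?_ 2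
  rcases le_total t Real.pi with h | h
  · have := Real.mul_le_sin (x := t / 2) (by linarith) (by linarith)
    have h3 : min t (2 * Real.pi - t) ≤ t := min_le_left _ _
    have h4 : 2 / Real.pi * min t (2 * Real.pi - t) ≤ 2 / Real.pi * t := by gcongr
    linarith
  · have := Real.mul_le_sin (x := Real.pi - t / 2) (by linarith) (by linarith)
    rw [Real.sin_pi_sub] at this
    have h3 : min t (2 * Real.pi - t) ≤ 2 * Real.pi - t := min_le_right _ _
    have h4 : 2 / Real.pi * min t (2 * Real.pi - t) ≤ 2 / Real.pi * (2 * Real.pi - t) := by gcongr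
    linarith

lemma g_integrable {γ : ℝ} (hγ : γ < 1) :
    Integrable (fun t : ℝ => (2 / Real.pi) ^ (-γ) * (t ^ (-γ) + (2 * Real.pi - t) ^ (-γ)))
      ((volume : Measure ℝ).restrict (Set.Icc 0 (2 * Real.pi))) := by
  have hpi := Real.pi_pos
  have h1 : IntervalIntegrable (fun t : ℝ => t ^ (-γ)) volume 0 (2 * Real.pi) :=
    intervalIntegral.intervalIntegrable_rpow' (by linarith)
  have h2 := h1.comp_sub_left (2 * Real.pi)
  simp only [sub_zero, sub_self] at h2
  have h3 := (h1.add h2.symm).const_mul ((2 / Real.pi) ^ (-γ))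
  rw [intervalIntegrable_iff_integrableOn_Icc_of_le (by positivity)] at h3
  exact h3

lemma muk_rpow_integrable (hd : 0 < d) {α : ℝ} (hα : α ∈ Set.Ioo (0 : ℝ) (d : ℝ)) :
    Integrable (fun k => muk d k ^ (-(α / 2)))
      ((volume : Measure (Fin d → ℝ)).restrict (box d)) := by
  have hd' : (0 : ℝ) < d := by exact_mod_cast hd
  have hpi := Real.pi_pos
  set γ := α / d with hγ
  have hγ0 : 0 < γ := div_pos hα.1 hd'
  have hγ1 : γ < 1 := (div_lt_one hd').mpr hα.2
  have hI := g_integrable hγ1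
  have hP := Integrable.fintype_prod (ι := Fin d) (𝕜 := ℝ)
    (μ := fun _ => (volume : Measure ℝ).restrict (Set.Icc 0 (2 * Real.pi)))
    (f := fun _ t => (2 / Real.pi) ^ (-γ) * (t ^ (-γ) + (2 * Real.pi - t) ^ (-γ)))
    (fun _ => hI)
  rw [← box_measure] at hP
  refine hP.mono' ?_ ?_
  · have : Measurable (fun k => muk d k ^ (-(α / 2))) := by
      unfold muk
      fun_prop
    exact this.aestronglyMeasurable
  · filter_upwards [ae_box d] with k hk
    have hm0 := muk_nonneg k
    rw [Real.norm_of_nonneg (Real.rpow_nonneg hm0 _)]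
    have e : muk d k ^ (-(α / 2)) = ∏ _j : Fin d, muk d k ^ (-(γ / 2)) := by
      rw [Finset.prod_const, Finset.card_univ, Fintype.card_fin, ← Real.rpow_natCast,
          ← Real.rpow_mul hm0]
      congr 1
      rw [hγ]; field_simp
    rw [e]
    refine Finset.prod_le_prod (fun j _ => Real.rpow_nonneg hm0 _) fun j _ => ?_
    obtain ⟨hk0, hk1⟩ := hk j
    have hm : 0 < min (k j) (2 * Real.pi - k j) := lt_min hk0 (by linarith)
    have h1 := (one_sub_cos_lower hk0 hk1).trans (muk_ge k j)
    have h2 : 0 < 2 / Real.pi * min (k j) (2 * Real.pi - k j) := by positivity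
    calc muk d k ^ (-(γ / 2)) ≤
          ((2 / Real.pi * min (k j) (2 * Real.pi - k j)) ^ 2) ^ (-(γ / 2)) :=
          Real.rpow_le_rpow_of_nonpos (by positivity) h1 (by linarith)
      _ = (2 / Real.pi * min (k j) (2 * Real.pi - k j)) ^ (-γ) := by
          rw [← Real.rpow_natCast, ← Real.rpow_mul h2.le]
          congr 1; push_cast; ring
      _ = (2 / Real.pi) ^ (-γ) * (min (k j) (2 * Real.pi - k j)) ^ (-γ) :=
          Real.mul_rpow (by positivity) hm.le
      _ ≤ _ := by
          gcongr
          have ha : 0 ≤ (k j) ^ (-γ) := Real.rpow_nonneg hk0.le _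
          have hb : 0 ≤ (2 * Real.pi - k j) ^ (-γ) := Real.rpow_nonneg (by linarith) _
          rcases min_choice (k j) (2 * Real.pi - k j) with h | h <;> rw [h] <;> linarith

/-- phase -/
def ph (m : Z d) (k : Fin d → ℝ) : ℝ := ∑ j, (m j : ℝ) * k j

lemma ph_continuous (m : Z d) : Continuous (ph m) := by unfold ph; fun_prop

instance box_finite (d : ℕ) :
    IsFiniteMeasure ((volume : Measure (Fin d → ℝ)).restrict (box d)) := by
  rw [box_measure]; infer_instance

lemma integral_cexp_nonneg (n : ℤ) : ∃ r : ℝ, 0 ≤ r ∧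
    ∫ t in Set.Icc 0 (2 * Real.pi), Complex.exp ((n * t : ℝ) * Complex.I) = (r : ℂ) := by
  have hpi := Real.pi_pos
  rw [integral_Icc_eq_integral_Ioc, ← intervalIntegral.integral_of_le (by positivity)]
  by_cases hn : n = 0
  · refine ⟨2 * Real.pi, by positivity, ?_⟩
    simp [hn]
  · refine ⟨0, le_rfl, ?_⟩
    have hc : (n : ℂ) * Complex.I ≠ 0 := by simp [hn]
    have := integral_exp_mul_complex (a := 0) (b := 2 * Real.pi) hc
    have e : ∀ t : ℝ, Complex.exp ((n * t : ℝ) * Complex.I) =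
      Complex.exp ((n : ℂ) * Complex.I * t) := by
      intro t; congr 1; push_cast; ring
    simp only [e]
    rw [this]
    have h2 : Complex.exp ((n : ℂ) * Complex.I * ((2 * Real.pi : ℝ) : ℂ)) = 1 := by
      rw [Complex.exp_eq_one_iff]
      exact ⟨n, by push_cast; ring⟩
    rw [h2]
    simp

lemma base_nonneg (m : Z d) : 0 ≤ ∫ k in box d, Real.cos (ph m k) := by
  choose r hr0 hr using integral_cexp_nonneg
  have h1 : ∫ k in box d, Complex.exp ((ph m k : ℝ) * Complex.I) = ((∏ j, r (m j) : ℝ) : ℂ) := by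
    have := integral_fintype_prod_eq_prod (ι := Fin d) (𝕜 := ℂ) (E := fun _ => ℝ)
      (fun j t => Complex.exp ((m j * t : ℝ) * Complex.I))
      (μ := fun _ => (volume : Measure ℝ).restrict (Set.Icc 0 (2 * Real.pi)))
    rw [box_measure]
    simp only [hr] at this
    push_cast
    rw [← this]
    congr 1
    ext k
    rw [← Complex.exp_sum]
    congr 1
    unfold ph
    push_cast
    rw [Finset.sum_mul]
  have hintg : Integrable (fun k => Complex.exp ((ph m k : ℝ) * Complex.I))
      ((volume : Measure (Fin d → ℝ)).restrict (box d)) := by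
    refine Integrable.of_bound (C := 1) ?_ (ae_of_all _ fun k => ?_)
    · have := ph_continuous m
      exact Continuous.aestronglyMeasurable (by fun_prop)
    · rw [Complex.norm_exp_ofReal_mul_I]
  have h2 := integral_re hintg
  have h3 : ∀ k, RCLike.re (Complex.exp ((ph m k : ℝ) * Complex.I)) = Real.cos (ph m k) := by
    intro k
    exact Complex.exp_ofReal_mul_I_re _
  simp only [h3] at h2
  rw [h2, h1]
  change 0 ≤ ((∏ j, r (m j) : ℝ) : ℂ).re
  rw [Complex.ofReal_re]
  exact Finset.prod_nonneg fun j _ => hr0 (m j)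

/-- sum of cosines -/
def cS (k : Fin d → ℝ) : ℝ := ∑ j, Real.cos (k j)

lemma cS_continuous : Continuous (cS (d := d)) := by unfold cS; fun_prop

lemma cS_abs (k : Fin d → ℝ) : |cS k| ≤ d := by
  unfold cS
  refine (Finset.abs_sum_le_sum_abs _ _).trans ?_
  refine (Finset.sum_le_sum fun j _ => Real.abs_cos_le_one _).trans ?_
  simp

lemma cos_pow_integrable (m : Z d) (n : ℕ) :
    Integrable (fun k => Real.cos (ph m k) * cS k ^ n)
      ((volume : Measure (Fin d → ℝ)).restrict (box d)) := by
  refine Integrable.of_bound (C := (d : ℝ) ^ n) ?_ (ae_of_all _ fun k => ?_)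
  · have := ph_continuous m
    have := cS_continuous (d := d)
    exact Continuous.aestronglyMeasurable (by fun_prop)
  · rw [norm_mul, norm_pow, Real.norm_eq_abs, Real.norm_eq_abs]
    calc _ ≤ 1 * (d : ℝ) ^ n := by
          gcongr
          · exact Real.abs_cos_le_one _
          · exact cS_abs k
      _ = _ := one_mul _

lemma pow_nonneg_int (n : ℕ) : ∀ m : Z d, 0 ≤ ∫ k in box d, Real.cos (ph m k) * cS k ^ n := by
  induction n with
  | zero => intro m; simpa using base_nonneg m
  | succ n ih =>
    intro m
    have e : ∀ k, Real.cos (ph m k) * cS k ^ (n + 1) =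
        ∑ j, (1 / 2 * (Real.cos (ph (m + Pi.single j 1) k) * cS k ^ n) +
          1 / 2 * (Real.cos (ph (m - Pi.single j 1) k) * cS k ^ n)) := by
      intro k
      have h : ∀ j, Real.cos (ph (m + Pi.single j 1) k) + Real.cos (ph (m - Pi.single j 1) k) =
          2 * Real.cos (ph m k) * Real.cos (k j) := by
        intro j
        have h1 : ph (m + Pi.single j 1) k = ph m k + k j := by
          unfold ph
          simp [add_mul, Finset.sum_add_distrib, Pi.single_apply]
        have h2 : ph (m - Pi.single j 1) k = ph m k - k j := by
          unfold ph
          simp [sub_mul, Finset.sum_sub_distrib, Pi.single_apply]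
        rw [h1, h2, Real.cos_add, Real.cos_sub]; ring
      calc Real.cos (ph m k) * cS k ^ (n + 1)
          = Real.cos (ph m k) * cS k ^ n * ∑ j, Real.cos (k j) := by
            rw [pow_succ]; unfold cS; ring
        _ = ∑ j, Real.cos (ph m k) * cS k ^ n * Real.cos (k j) := by rw [Finset.mul_sum]
        _ = _ := by
            refine Finset.sum_congr rfl fun j _ => ?_
            have := h j
            linear_combination (-(1 / 2) * cS k ^ n) * this
    simp only [e]
    rw [integral_finsetSum]
    · refine Finset.sum_nonneg fun j _ => ?_
      rw [integral_add ((cos_pow_integrable _ n).const_mul _) ((cos_pow_integrable _ n).const_mul _),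
        integral_const_mul, integral_const_mul]
      have := ih (m + Pi.single j 1)
      have := ih (m - Pi.single j 1)
      positivity
    · intro j _
      exact ((cos_pow_integrable _ n).const_mul _).add ((cos_pow_integrable _ n).const_mul _)

lemma exp_nonneg_int (m : Z d) {c : ℝ} (hc : 0 ≤ c) :
    0 ≤ ∫ k in box d, Real.cos (ph m k) * Real.exp (c * cS k) := by
  have hsum := Real.summable_pow_div_factorial (c * d)
  have := hasSum_integral_of_dominated_convergence
    (μ := (volume : Measure (Fin d → ℝ)).restrict (box d))
    (F := fun (n : ℕ) k => c ^ n / n.factorial * (Real.cos (ph m k) * cS k ^ n))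
    (f := fun k => Real.cos (ph m k) * Real.exp (c * cS k))
    (fun n _ => (c * d) ^ n / n.factorial)
    (fun n => ((cos_pow_integrable m n).const_mul _).aestronglyMeasurable)
    (fun n => ae_of_all _ fun k => by
      rw [Real.norm_eq_abs, abs_mul, abs_mul, abs_pow, abs_of_nonneg (by positivity), mul_pow,
        mul_div_right_comm]
      calc _ ≤ c ^ n / n.factorial * (1 * (d : ℝ) ^ n) := by
            gcongr
            · exact Real.abs_cos_le_one _
            · exact cS_abs k
        _ = _ := by ring)
    (ae_of_all _ fun _ => hsum)
    (integrable_const _)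
    (ae_of_all _ fun k => by
      have h := (NormedSpace.expSeries_div_hasSum_exp (c * cS k)).mul_left (Real.cos (ph m k))
      rw [← Real.exp_eq_exp_ℝ] at h
      refine h.congr_fun ?_
      intro n
      rw [mul_pow]; ring)
  refine this.nonneg fun n => ?_
  rw [integral_const_mul]
  have := pow_nonneg_int n m
  positivity

lemma muk_eq_s12 (k : Fin d → ℝ) : muk d k = 2 * d - 2 * cS k := rfl

lemma muk_continuous : Continuous (muk d) := by unfold muk; fun_prop

lemma ae_muk_pos (hd : 0 < d) : ∀ᵐ k ∂(volume : Measure (Fin d → ℝ)).restrict (box d),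
    0 < muk d k := by
  filter_upwards [ae_box d] with k hk
  obtain ⟨h0, h1⟩ := hk ⟨0, hd⟩
  refine lt_of_lt_of_le ?_ ((one_sub_cos_lower h0 h1).trans (muk_ge k _))
  have hpi := Real.pi_pos
  have : 0 < min (k ⟨0, hd⟩) (2 * Real.pi - k ⟨0, hd⟩) := lt_min h0 (by linarith)
  positivity

lemma green_nonneg (hd : 0 < d) {α : ℝ} (hα : α ∈ Set.Ioo (0 : ℝ) (d : ℝ)) (m : Z d) :
    0 ≤ ∫ k in box d, Real.cos (ph m k) * muk d k ^ (-(α / 2)) := by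
  set β := α / 2 with hβ
  have hβ0 : 0 < β := by have := hα.1; positivity
  set ν := (volume : Measure (Fin d → ℝ)).restrict (box d) with hν
  set ρ := (volume : Measure ℝ).restrict (Set.Ioi 0) with hρ
  have hΓ : 0 < Real.Gamma β := Real.Gamma_pos_of_pos hβ0
  have hphc := ph_continuous m
  have hmuc := muk_continuous (d := d)
  have hkey : ∀ r : ℝ, 0 < r →
      ∫ t, t ^ (β - 1) * Real.exp (-(r * t)) ∂ρ = r ^ (-β) * Real.Gamma β := by
    intro r hr
    rw [hρ, Real.integral_rpow_mul_exp_neg_mul_Ioi hβ0 hr, one_div, Real.inv_rpow hr.le,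
      Real.rpow_neg hr.le]
  have hki : ∀ r : ℝ, 0 < r → Integrable (fun t => t ^ (β - 1) * Real.exp (-(r * t))) ρ := by
    intro r hr
    refine Integrable.of_integral_ne_zero ?_
    rw [hkey r hr]
    positivity
  let G : (Fin d → ℝ) → ℝ → ℝ := fun k t =>
    Real.cos (ph m k) * (t ^ (β - 1) * Real.exp (-(muk d k * t)))
  have hGm : Measurable (Function.uncurry G) := by
    have h1 : Measurable fun z : (Fin d → ℝ) × ℝ => Real.cos (ph m z.1) :=
      (Continuous.measurable (by fun_prop))
    have h2 : Measurable fun z : (Fin d → ℝ) × ℝ => Real.exp (-(muk d z.1 * z.2)) :=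
      (Continuous.measurable (by fun_prop))
    have h3 : Measurable fun z : (Fin d → ℝ) × ℝ => z.2 ^ (β - 1) := by fun_prop
    exact h1.mul (h3.mul h2)
  have hGi : Integrable (Function.uncurry G) (ν.prod ρ) := by
    rw [integrable_prod_iff hGm.aestronglyMeasurable]
    constructor
    · filter_upwards [ae_muk_pos hd] with k hk
      exact (hki _ hk).const_mul (Real.cos (ph m k))
    · have hI : Integrable (fun k => |Real.cos (ph m k)| * (muk d k ^ (-β) * Real.Gamma β)) ν := by
        refine ((muk_rpow_integrable hd hα).mul_const (Real.Gamma β)).bdd_mul (c := 1) ?_ ?_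
        · exact Continuous.aestronglyMeasurable (by fun_prop)
        · refine ae_of_all _ fun k => ?_
          simpa using Real.abs_cos_le_one _
      refine hI.congr ?_
      filter_upwards [ae_muk_pos hd] with k hk
      rw [← hkey _ hk, ← integral_const_mul]
      refine setIntegral_congr_fun measurableSet_Ioi fun t ht => ?_
      have ht' : (0 : ℝ) < t := ht
      change _ = ‖G k t‖
      simp only [G]
      rw [norm_mul, Real.norm_eq_abs, Real.norm_of_nonneg (by positivity)]
  have h1 : ∫ k, Real.cos (ph m k) * muk d k ^ (-β) ∂ν =
      (Real.Gamma β)⁻¹ * ∫ k, ∫ t, G k t ∂ρ ∂ν := by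
    rw [← integral_const_mul]
    refine integral_congr_ae ?_
    filter_upwards [ae_muk_pos hd] with k hk
    simp only [G]
    rw [integral_const_mul, hkey _ hk]
    field_simp
  rw [h1, integral_integral_swap hGi]
  refine mul_nonneg (by positivity) ?_
  refine setIntegral_nonneg measurableSet_Ioi fun t ht => ?_
  have ht' : (0 : ℝ) < t := ht
  have e : ∀ k, G k t = (t ^ (β - 1) * Real.exp (-(2 * d * t))) *
      (Real.cos (ph m k) * Real.exp (2 * t * cS k)) := by
    intro k
    have : Real.exp (-(muk d k * t)) = Real.exp (-(2 * d * t)) * Real.exp (2 * t * cS k) := by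
      rw [← Real.exp_add, muk_eq_s12]; congr 1; ring
    simp only [G]
    rw [this]; ring
  simp only [e]
  rw [integral_const_mul]
  exact mul_nonneg (by positivity) (exp_nonneg_int m (by positivity))

lemma Kfrac_nonneg (α : ℝ) : 0 ≤ Kfrac d α := by
  unfold Kfrac
  have hpi := Real.pi_pos
  refine mul_nonneg (by positivity) (integral_nonneg fun k => Real.rpow_nonneg (muk_nonneg k) _)

lemma riesz_bound (hd : 0 < d) {α : ℝ} (hα : α ∈ Set.Ioo (0 : ℝ) (d : ℝ)) :
    ∃ R : ℝ, 0 < R ∧ ∀ x y : Z d, 0 ≤ Riesz d α x y ∧ Riesz d α x y ≤ R := by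
  have hpi := Real.pi_pos
  set I := ∫ k in box d, muk d k ^ (-(α / 2)) with hI
  have hI0 : 0 ≤ I := integral_nonneg fun k => Real.rpow_nonneg (muk_nonneg k) _
  have hK := Kfrac_nonneg (d := d) α
  refine ⟨Kfrac d α * (2 * Real.pi) ^ (-(d : ℝ)) * I + 1, by positivity, ?_⟩
  intro x y
  have e : Riesz d α x y = Kfrac d α * (2 * Real.pi) ^ (-(d : ℝ)) *
      ∫ k in box d, Real.cos (ph (x - y) k) * muk d k ^ (-(α / 2)) := rfl
  rw [e]
  constructor
  · exact mul_nonneg (by positivity) (green_nonneg hd hα _)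
  · have hle : ∫ k in box d, Real.cos (ph (x - y) k) * muk d k ^ (-(α / 2)) ≤ I := by
      have hb := muk_rpow_integrable hd hα
      have hphc := ph_continuous (x - y)
      refine integral_mono (hb.bdd_mul (c := 1) ?_ ?_) hb ?_
      · exact Continuous.aestronglyMeasurable (by fun_prop)
      · refine ae_of_all _ fun k => ?_
        simpa using Real.abs_cos_le_one _
      · intro k
        exact mul_le_of_le_one_left (Real.rpow_nonneg (muk_nonneg k) _) (Real.cos_le_one _)
    have : Kfrac d α * (2 * Real.pi) ^ (-(d : ℝ)) *
      ∫ k in box d, Real.cos (ph (x - y) k) * muk d k ^ (-(α / 2)) ≤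
      Kfrac d α * (2 * Real.pi) ^ (-(d : ℝ)) * I := by gcongr
    linarith

lemma f_local {f : ℝ → ℝ} {p : ℝ} (hp : 2 ≤ p) (hfc : Continuous f) (hfz : ∀ t ≤ (0 : ℝ), f t = 0)
    (hf1 : F1 f p) (M : ℝ) :
    ∃ C : ℝ, 0 < C ∧ ∀ t, 0 ≤ t → t ≤ M → |f t| ≤ C * t ^ (p - 1) := by
  obtain ⟨δ, hδ, h1⟩ := hf1 1 one_pos
  obtain ⟨B, hB⟩ := (isCompact_Icc (a := δ) (b := M)).exists_bound_of_continuousOn hfc.continuousOn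
  have hδp : 0 < δ ^ (p - 1) := Real.rpow_pos_of_pos hδ _
  refine ⟨1 + |B| / δ ^ (p - 1), by positivity, ?_⟩
  intro t ht0 htM
  have htp : 0 ≤ t ^ (p - 1) := Real.rpow_nonneg ht0 _
  have hq : 0 ≤ |B| / δ ^ (p - 1) := by positivity
  rcases ht0.eq_or_lt with h | h
  · rw [← h, hfz 0 le_rfl, abs_zero]
    rw [← h] at htp
    positivity
  rcases lt_or_ge t δ with h2 | h2
  · have := h1 t h h2
    nlinarith [mul_nonneg hq htp]
  · have h3 := hB t ⟨h2, htM⟩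
    rw [Real.norm_eq_abs] at h3
    have h4 : δ ^ (p - 1) ≤ t ^ (p - 1) := Real.rpow_le_rpow hδ.le h2 (by linarith)
    have h5 : |B| ≤ |B| / δ ^ (p - 1) * t ^ (p - 1) := by
      rw [div_mul_eq_mul_div, le_div_iff₀ hδp]
      gcongr
    have := le_abs_self B
    nlinarith

lemma pos_le_abs (u : Z d → ℝ) (x : Z d) : pos u x ≤ |u x| := max_le (le_abs_self _) (abs_nonneg _)

lemma pos_nonneg' (u : Z d → ℝ) (x : Z d) : 0 ≤ pos u x := le_max_right _ _

lemma Fint_zero (f : ℝ → ℝ) : Fint f 0 = 0 := by simp [Fint]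

/-- nonlinear part bounds -/
structure NL (α p θ : ℝ) (f : ℝ → ℝ) (C : ℝ) (u : Z d → ℝ) : Prop where
  c0 : ∀ x, 0 ≤ conv d α (fun y => Fint f (pos u y)) x
  c1 : ∀ x, conv d α (fun y => Fint f (pos u y)) x ≤ C
  f0 : ∀ x, 0 ≤ f (pos u x)
  f1 : ∀ x, f (pos u x) ≤ C * |u x| ^ (p - 1)
  F0 : ∀ x, 0 ≤ Fint f (pos u x)
  F1 : ∀ x, Fint f (pos u x) ≤ C * |u x| ^ p
  ar : ∀ x, θ * Fint f (pos u x) ≤ 2 * (f (pos u x) * u x)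

lemma abs_le_of_tsum {p A : ℝ} (hp : 2 ≤ p) {u : Z d → ℝ} (hu : Summable fun x => |u x| ^ p)
    (hA : ∑' x, |u x| ^ p ≤ A) (x : Z d) : |u x| ≤ A ^ (1 / p) := by
  have h1 : |u x| ^ p ≤ A :=
    (term_le_tsum (a := fun x => |u x| ^ p) (fun x => by positivity) hu x).trans hA
  calc |u x| = (|u x| ^ p) ^ (1 / p) := by
        rw [← Real.rpow_mul (abs_nonneg _), mul_one_div_cancel (by linarith), Real.rpow_one]
    _ ≤ _ := by gcongr

lemma nonlin (hd : 0 < d) {α : ℝ} (hα : α ∈ Set.Ioo (0 : ℝ) (d : ℝ))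
    {f : ℝ → ℝ} {p θ : ℝ} (hp : 2 ≤ p) (hθ : p < θ) (hfc : Continuous f)
    (hfz : ∀ t ≤ (0 : ℝ), f t = 0) (hf1 : F1 f p) (hf3 : F3 f θ) (A : ℝ) :
    ∃ C : ℝ, 0 < C ∧ ∀ u : Z d → ℝ, (Summable fun x => |u x| ^ p) → ∑' x, |u x| ^ p ≤ A →
      NL α p θ f C u := by
  obtain ⟨R, hR, hRb⟩ := riesz_bound hd hα
  obtain ⟨Cf, hCf, hf⟩ := f_local hp hfc hfz hf1 (A ^ (1 / p))
  have hθ0 : 0 < θ := by linarith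
  refine ⟨Cf + R * (Cf * |A|), by positivity, ?_⟩
  intro u hu hA
  have hx := abs_le_of_tsum hp hu hA
  have hA0 : 0 ≤ A := le_trans (tsum_nonneg fun x => by positivity) hA
  have hRC : 0 ≤ R * (Cf * |A|) := by positivity
  have hfb : ∀ x, |f (pos u x)| ≤ Cf * |u x| ^ (p - 1) := by
    intro x
    refine (hf _ (pos_nonneg' u x) ((pos_le_abs u x).trans (hx x))).trans ?_
    have := pos_nonneg' u x
    have := pos_le_abs u x
    have : 0 ≤ p - 1 := by linarith
    gcongr
  have hcase : ∀ x, (pos u x = 0 ∧ u x ≤ 0) ∨ (0 < pos u x ∧ pos u x = u x) := by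
    intro x
    unfold pos
    rcases le_or_gt (u x) 0 with h | h
    · left; exact ⟨max_eq_right h, h⟩
    · right; rw [max_eq_left h.le]; exact ⟨h, rfl⟩
  have hf0 : ∀ x, 0 ≤ f (pos u x) := by
    intro x
    rcases hcase x with ⟨h, _⟩ | ⟨h, h'⟩
    · rw [h, hfz 0 le_rfl]
    · obtain ⟨h1, h2⟩ := hf3 _ h
      by_contra hcon
      push Not at hcon
      nlinarith [mul_pos (neg_pos.mpr hcon) h]
  have hF0 : ∀ x, 0 ≤ Fint f (pos u x) := by
    intro x
    rcases hcase x with ⟨h, _⟩ | ⟨h, h'⟩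
    · rw [h, Fint_zero]
    · obtain ⟨h1, h2⟩ := hf3 _ h
      exact nonneg_of_mul_nonneg_right h1 hθ0
  have har : ∀ x, θ * Fint f (pos u x) ≤ 2 * (f (pos u x) * u x) := by
    intro x
    rcases hcase x with ⟨h, _⟩ | ⟨h, h'⟩
    · rw [h, Fint_zero, hfz 0 le_rfl]; simp
    · obtain ⟨h1, h2⟩ := hf3 _ h
      have h3 : f (pos u x) * pos u x = f (pos u x) * u x :=
        congrArg (fun t => f (pos u x) * t) h'
      linarith
  have hpow : ∀ x, |u x| ^ p = |u x| ^ (p - 1) * |u x| := by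
    intro x
    rw [← Real.rpow_add_one' (abs_nonneg _) (by linarith)]
    congr 1; ring
  have hF1 : ∀ x, Fint f (pos u x) ≤ Cf * |u x| ^ p := by
    intro x
    have h1 := har x
    have h2 : f (pos u x) * u x ≤ Cf * |u x| ^ p := by
      rw [hpow]
      calc f (pos u x) * u x ≤ |f (pos u x)| * |u x| := by
            rw [← abs_mul]; exact le_abs_self _
        _ ≤ Cf * |u x| ^ (p - 1) * |u x| := by gcongr; exact hfb x
        _ = _ := by ring
    have h3 := hF0 x
    nlinarith
  have hFs : Summable fun x => Fint f (pos u x) :=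
    Summable.of_nonneg_of_le hF0 hF1 (hu.mul_left Cf)
  have hFt : ∑' x, Fint f (pos u x) ≤ Cf * |A| := by
    calc _ ≤ ∑' x, Cf * |u x| ^ p := hFs.tsum_le_tsum hF1 (hu.mul_left Cf)
      _ = Cf * ∑' x, |u x| ^ p := tsum_mul_left
      _ ≤ _ := by gcongr; exact hA.trans (le_abs_self _)
  have hcn : ∀ x y, 0 ≤ Riesz d α x y * Fint f (pos u y) := fun x y =>
    mul_nonneg (hRb x y).1 (hF0 y)
  have hcl : ∀ x y, Riesz d α x y * Fint f (pos u y) ≤ R * Fint f (pos u y) := fun x y =>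
    mul_le_mul_of_nonneg_right (hRb x y).2 (hF0 y)
  refine ⟨fun x => tsum_nonneg (hcn x), fun x => ?_, hf0, fun x => ?_, hF0, fun x => ?_, har⟩
  · have hs : Summable fun y => Riesz d α x y * Fint f (pos u y) :=
      Summable.of_nonneg_of_le (hcn x) (hcl x) (hFs.mul_left R)
    have : conv d α (fun y => Fint f (pos u y)) x ≤ R * (Cf * |A|) := by
      calc _ ≤ ∑' y, R * Fint f (pos u y) := hs.tsum_le_tsum (hcl x) (hFs.mul_left R)
        _ = R * ∑' y, Fint f (pos u y) := tsum_mul_left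
        _ ≤ _ := by gcongr
    linarith
  · refine (le_abs_self _).trans ((hfb x).trans ?_)
    gcongr
    linarith
  · refine (hF1 x).trans ?_
    gcongr
    linarith

section PartE
variable {W : Z d → Z d → ℝ} {K p h₀ : ℝ} {h : Z d → ℝ}

/-- Restriction of `w` to the finite set `S`. -/
def cut (S : Finset (Z d)) (w : Z d → ℝ) (x : Z d) : ℝ := by
  classical exact if x ∈ S then w x else 0

lemma cut_mem {S : Finset (Z d)} {x : Z d} (hx : x ∈ S) (w : Z d → ℝ) : cut S w x = w x := by
  simp [cut, hx]

lemma cut_not {S : Finset (Z d)} {x : Z d} (hx : x ∉ S) (w : Z d → ℝ) : cut S w x = 0 := by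
  simp [cut, hx]

lemma memH_of (hK : KB W K) (hp : 2 ≤ p) (hh₀ : 0 < h₀) (hh1 : ∀ x, h₀ ≤ h x) :
    ∃ C1 : ℝ, 0 < C1 ∧ ∀ u : Z d → ℝ, (Summable fun x => h x * |u x| ^ p) →
      (Summable fun x => |u x| ^ p) ∧ (Summable fun x => gradNorm W u x ^ p) ∧
      h₀ * ∑' x, |u x| ^ p ≤ ∑' x, h x * |u x| ^ p ∧
      HnormP W h p u = ∑' x, gradNorm W u x ^ p + ∑' x, h x * |u x| ^ p ∧
      memH W h p u ∧ HnormP W h p u ≤ C1 * ∑' x, h x * |u x| ^ p := by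
  obtain ⟨CG, hCG, hb⟩ := gradP_bound hK hp
  refine ⟨CG / h₀ + 1, by positivity, fun u hu => ?_⟩
  have hle : ∀ x, h₀ * |u x| ^ p ≤ h x * |u x| ^ p := fun x =>
    mul_le_mul_of_nonneg_right (hh1 x) (by positivity)
  have hs0 : Summable fun x => h₀ * |u x| ^ p :=
    Summable.of_nonneg_of_le (fun x => by positivity) hle hu
  have hs : Summable fun x => |u x| ^ p := (summable_mul_left_iff hh₀.ne').1 hs0
  obtain ⟨h1, h2, h3⟩ := hb u hs
  have h4 : h₀ * ∑' x, |u x| ^ p ≤ ∑' x, h x * |u x| ^ p := by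
    rw [← tsum_mul_left]; exact hs0.tsum_le_tsum hle hu
  have h5 : HnormP W h p u = ∑' x, gradNorm W u x ^ p + ∑' x, h x * |u x| ^ p :=
    h2.tsum_add hu
  refine ⟨hs, h2, h4, h5, ⟨h1, h2.add hu⟩, ?_⟩
  rw [h5, add_mul, one_mul]
  have h6 : ∑' x, |u x| ^ p ≤ (∑' x, h x * |u x| ^ p) / h₀ := by
    rw [le_div_iff₀ hh₀]; linarith
  have h7 : CG / h₀ * ∑' x, h x * |u x| ^ p = CG * ((∑' x, h x * |u x| ^ p) / h₀) := by ring
  have h8 := mul_le_mul_of_nonneg_left h6 hCG.le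
  linarith

lemma memH_summ (hh₀ : 0 < h₀) (hh1 : ∀ x, h₀ ≤ h x) {u : Z d → ℝ} (hu : memH W h p u) :
    Summable fun x => h x * |u x| ^ p := by
  refine Summable.of_nonneg_of_le (fun x => ?_) (fun x => ?_) hu.2
  · exact mul_nonneg (hh₀.le.trans (hh1 x)) (by positivity)
  · have := Real.rpow_nonneg (gradNorm_nonneg W u x) p
    linarith

lemma gradForm_smul (u φ : Z d → ℝ) (c : ℝ) (x : Z d) :
    gradForm W u (fun x => c * φ x) x = c * gradForm W u φ x := by
  unfold gradForm
  have : (fun y => W x y * (u x - u y) * (c * φ x - c * φ y)) =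
      fun y => c * (W x y * (u x - u y) * (φ x - φ y)) := by
    funext y; ring
  rw [this, tsum_mul_left]; ring

lemma gradNorm_smul (φ : Z d → ℝ) (c : ℝ) (x : Z d) :
    gradNorm W (fun x => c * φ x) x = |c| * gradNorm W φ x := by
  unfold gradNorm
  have : (fun y => W x y * (c * φ x - c * φ y) ^ 2) =
      fun y => c ^ 2 * (W x y * (φ x - φ y) ^ 2) := by
    funext y; ring
  rw [this, tsum_mul_left, ← Real.sqrt_sq_eq_abs, ← Real.sqrt_mul (sq_nonneg c)]
  congr 1; ring

lemma HnormP_smul (φ : Z d → ℝ) (c : ℝ) :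
    HnormP W h p (fun x => c * φ x) = |c| ^ p * HnormP W h p φ := by
  unfold HnormP
  rw [← tsum_mul_left]
  congr 1; funext x
  rw [gradNorm_smul, abs_mul, Real.mul_rpow (abs_nonneg _) (gradNorm_nonneg W φ x),
    Real.mul_rpow (abs_nonneg _) (abs_nonneg _)]
  ring

lemma pairing_smul {α : ℝ} {f : ℝ → ℝ} (u φ : Z d → ℝ) (c : ℝ) :
    pairing W h p α f u (fun x => c * φ x) = c * pairing W h p α f u φ := by
  unfold pairing
  rw [mul_sub, ← tsum_mul_left, ← tsum_mul_left]
  congr 1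
  · congr 1; funext x
    rw [gradForm_smul]; ring
  · congr 1; funext x; ring

lemma pairing_test (hp : 2 ≤ p) (hh0 : ∀ x, 0 ≤ h x) {α e : ℝ} {f : ℝ → ℝ} {u : Z d → ℝ}
    (ht : ∀ φ : Z d → ℝ, (Function.support φ).Finite → normH W h p φ ≤ 1 →
      |pairing W h p α f u φ| ≤ e)
    {φ : Z d → ℝ} (hφ : (Function.support φ).Finite) {B : ℝ} (hB : 0 < B)
    (hle : HnormP W h p φ ≤ B ^ p) : |pairing W h p α f u φ| ≤ e * B := by
  have hp0 : 0 < p := by linarith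
  have hH0 : 0 ≤ HnormP W h p φ := tsum_nonneg fun x =>
    add_nonneg (Real.rpow_nonneg (gradNorm_nonneg W φ x) p)
      (mul_nonneg (hh0 x) (by positivity))
  have h1 := ht (fun x => B⁻¹ * φ x) (hφ.subset ?_) ?_
  · rw [pairing_smul, abs_mul, abs_of_pos (by positivity : 0 < B⁻¹)] at h1
    rw [inv_mul_le_iff₀ hB] at h1
    linarith
  · intro x hx hx0
    apply hx
    simp [hx0]
  · unfold normH
    rw [HnormP_smul, abs_of_pos (by positivity : 0 < B⁻¹)]
    have : B⁻¹ ^ p * HnormP W h p φ ≤ 1 := by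
      rw [Real.inv_rpow hB.le, inv_mul_le_iff₀ (by positivity)]
      linarith
    exact Real.rpow_le_one (by positivity) this (by positivity)

lemma gradForm_sub (hK : KB W K) {u φ ψ : Z d → ℝ} {x : Z d}
    (hu : Summable fun y => W x y * (u x - u y) ^ 2)
    (hφ : Summable fun y => W x y * (φ x - φ y) ^ 2)
    (hψ : Summable fun y => W x y * (ψ x - ψ y) ^ 2) :
    gradForm W u (fun x => φ x - ψ x) x = gradForm W u φ x - gradForm W u ψ x := by
  have h1 := (gradForm_cs hK u φ x hu hφ).1
  have h2 := (gradForm_cs hK u ψ x hu hψ).1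
  unfold gradForm
  rw [← mul_sub, ← h1.tsum_sub h2]
  congr 2; funext y; ring

lemma gT_sub (hK : KB W K) (hp : 2 ≤ p) {u φ ψ : Z d → ℝ} (hu : Summable fun x => |u x| ^ p)
    (hφ : Summable fun x => |φ x| ^ p) (hψ : Summable fun x => |ψ x| ^ p) :
    gT W p u (fun x => φ x - ψ x) = gT W p u φ - gT W p u ψ := by
  obtain ⟨_, _, hg⟩ := gT_bound hK hp
  obtain ⟨_, _, hb⟩ := gradP_bound hK hp
  unfold gT
  rw [← (hg u φ hu hφ).1.tsum_sub (hg u ψ hu hψ).1]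
  congr 1; funext x
  rw [gradForm_sub hK ((hb u hu).1 x) ((hb φ hφ).1 x) ((hb ψ hψ).1 x)]
  ring

lemma gT_self (hK : KB W K) (hp : 2 ≤ p) (u : Z d → ℝ) :
    gT W p u u = ∑' x, gradNorm W u x ^ p := by
  unfold gT
  congr 1; funext x
  rw [gradForm_self hK]
  have := Real.rpow_add_natCast' (n := 2) (y := p - 2) (gradNorm_nonneg W u x)
    (by push_cast; linarith)
  rw [← this]; congr 1; push_cast; ring

lemma summ_fin {S : Finset (Z d)} {g : Z d → ℝ} (hg : ∀ x, x ∉ S → g x = 0) : Summable g :=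
  summable_of_ne_finset_zero (s := S) (fun x hx => hg x hx)

lemma abs_rpow_zero (hp : 2 ≤ p) {t : ℝ} (ht : t = 0) : |t| ^ p = 0 := by
  rw [ht, abs_zero, Real.zero_rpow (by linarith)]

lemma pairing_cut (hK : KB W K) (hp : 2 ≤ p) {α : ℝ} {f : ℝ → ℝ} {u : Z d → ℝ}
    (hu : Summable fun x => |u x| ^ p) (S : Finset (Z d)) (w : Z d → ℝ) :
    pairing W h p α f u (cut S w) = gT W p u (cut S w)
      + ∑ x ∈ S, h x * |u x| ^ (p - 2) * u x * w x
      - ∑ x ∈ S, conv d α (fun y => Fint f (pos u y)) x * f (pos u x) * w x := by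
  obtain ⟨_, _, hg⟩ := gT_bound hK hp
  have h1 : Summable fun x => |cut S w x| ^ p :=
    summ_fin (S := S) fun x hx => abs_rpow_zero hp (cut_not hx w)
  have h2 : Summable fun x => h x * |u x| ^ (p - 2) * u x * cut S w x :=
    summ_fin (S := S) fun x hx => by rw [cut_not hx, mul_zero]
  unfold pairing gT
  rw [(hg u _ hu h1).1.tsum_add h2,
    tsum_eq_sum (s := S) (f := fun x => h x * |u x| ^ (p - 2) * u x * cut S w x)
      (fun x hx => by rw [cut_not hx, mul_zero]),
    tsum_eq_sum (s := S)
      (f := fun x => conv d α (fun y => Fint f (pos u y)) x * f (pos u x) * cut S w x)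
      (fun x hx => by rw [cut_not hx, mul_zero])]
  congr 1
  · congr 1
    exact Finset.sum_congr rfl fun x hx => by rw [cut_mem hx]
  · exact Finset.sum_congr rfl fun x hx => by rw [cut_mem hx]

lemma cut_supp (S : Finset (Z d)) (w : Z d → ℝ) : (Function.support (cut S w)).Finite := by
  refine S.finite_toSet.subset fun x hx => ?_
  by_contra hn
  exact hx (cut_not hn w)

/-- Norm of a cut function. -/
lemma cut_norm (hp : 2 ≤ p) (S : Finset (Z d)) (w : Z d → ℝ) :
    (Summable fun x => h x * |cut S w x| ^ p) ∧
    ∑' x, h x * |cut S w x| ^ p = ∑ x ∈ S, h x * |w x| ^ p := by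
  have h0 : ∀ x, x ∉ S → h x * |cut S w x| ^ p = 0 := fun x hx => by
    rw [abs_rpow_zero hp (cut_not hx w), mul_zero]
  refine ⟨summ_fin h0, ?_⟩
  rw [tsum_eq_sum h0]
  exact Finset.sum_congr rfl fun x hx => by rw [cut_mem hx]

lemma cut_compl (hp : 2 ≤ p) (S : Finset (Z d)) {w : Z d → ℝ}
    (hw : Summable fun x => |w x| ^ p) :
    (Summable fun x => |w x - cut S w x| ^ p) ∧
    ∑' x, |w x - cut S w x| ^ p = ∑' x, |w x| ^ p - ∑ x ∈ S, |w x| ^ p := by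
  have h0 : ∀ x, x ∉ S → |cut S w x| ^ p = 0 := fun x hx => abs_rpow_zero hp (cut_not hx w)
  have h1 : (fun x => |w x - cut S w x| ^ p) = fun x => |w x| ^ p - |cut S w x| ^ p := by
    funext x
    by_cases hx : x ∈ S
    · rw [cut_mem hx, sub_self, sub_self]; exact abs_rpow_zero hp rfl
    · rw [cut_not hx, abs_rpow_zero hp rfl, sub_zero, sub_zero]
  rw [h1]
  refine ⟨hw.sub (summ_fin h0), ?_⟩
  rw [hw.tsum_sub (summ_fin h0), tsum_eq_sum (f := fun x => |cut S w x| ^ p) h0]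
  congr 1
  exact Finset.sum_congr rfl fun x hx => by rw [cut_mem hx]

end PartE

section PartE2
variable {W : Z d → Z d → ℝ} {K p h₀ : ℝ} {h : Z d → ℝ}

lemma abs_pow_split (hp : 2 ≤ p) (t : ℝ) : |t| ^ p = |t| ^ (p - 1) * |t| := by
  rw [← Real.rpow_add_one' (abs_nonneg _) (by linarith)]
  congr 1; ring

lemma abs_pow_split2 (hp : 2 ≤ p) (t : ℝ) : |t| ^ (p - 2) * t * t = |t| ^ p := by
  have := Real.rpow_add_natCast' (n := 2) (y := p - 2) (abs_nonneg t)
    (by push_cast; linarith)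
  have h2 : p - 2 + ((2 : ℕ) : ℝ) = p := by push_cast; ring
  rw [h2, sq_abs] at this
  rw [this]; ring

lemma ar_ineq (hK : KB W K) (hp : 2 ≤ p) (hh0 : ∀ x, 0 ≤ h x) {C1 : ℝ}
    (hC1 : 0 < C1) (hmem : ∀ u : Z d → ℝ, (Summable fun x => h x * |u x| ^ p) →
      HnormP W h p u ≤ C1 * ∑' x, h x * |u x| ^ p) {α θ C e B : ℝ} {f : ℝ → ℝ}
    {u : Z d → ℝ} (hθ : p < θ) (hC : 0 < C) (hnl : NL α p θ f C u)
    (hs : Summable fun x => |u x| ^ p) (hhs : Summable fun x => h x * |u x| ^ p)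
    (hH : HnormP W h p u = ∑' x, gradNorm W u x ^ p + ∑' x, h x * |u x| ^ p)
    (ht : ∀ φ : Z d → ℝ, (Function.support φ).Finite → normH W h p φ ≤ 1 →
      |pairing W h p α f u φ| ≤ e)
    (hB : 0 < B) (hle : C1 * ∑' x, h x * |u x| ^ p ≤ B ^ p) :
    (1 / p - 1 / θ) * HnormP W h p u ≤ energy W h p α f u + e * B / θ := by
  obtain ⟨CG, hCG, hg⟩ := gT_bound hK hp
  have hθ0 : 0 < θ := by linarith
  have hp0 : 0 < p := by linarith
  set cv := conv d α (fun y => Fint f (pos u y)) with hcv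
  have hQs : Summable fun x => cv x * f (pos u x) * u x := by
    refine Summable.of_norm_bounded (hs.mul_left (C * C)) fun x => ?_
    rw [Real.norm_eq_abs, abs_mul, abs_of_nonneg (mul_nonneg (hnl.c0 x) (hnl.f0 x)),
      abs_pow_split hp]
    calc cv x * f (pos u x) * |u x| ≤ C * (C * |u x| ^ (p - 1)) * |u x| := by
          have h1 := hnl.c1 x
          have h2 := hnl.f1 x
          have h3 := hnl.f0 x
          gcongr
      _ = _ := by ring
  have hFs : Summable fun x => cv x * Fint f (pos u x) := by
    refine Summable.of_nonneg_of_le (fun x => mul_nonneg (hnl.c0 x) (hnl.F0 x)) (fun x => ?_)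
      (hs.mul_left (C * C))
    calc cv x * Fint f (pos u x) ≤ C * (C * |u x| ^ p) := by
          have h1 := hnl.c1 x
          have h2 := hnl.F1 x
          have h3 := hnl.F0 x
          gcongr
      _ = _ := by ring
  have hFQ : ∑' x, cv x * Fint f (pos u x) ≤ (2 / θ) * ∑' x, cv x * f (pos u x) * u x := by
    rw [← tsum_mul_left]
    refine hFs.tsum_le_tsum (fun x => ?_) (hQs.mul_left _)
    have h1 : Fint f (pos u x) ≤ (2 / θ) * (f (pos u x) * u x) := by
      rw [div_mul_eq_mul_div, le_div_iff₀ hθ0]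
      have := hnl.ar x
      linarith
    calc _ ≤ cv x * ((2 / θ) * (f (pos u x) * u x)) :=
          mul_le_mul_of_nonneg_left h1 (hnl.c0 x)
      _ = _ := by ring
  have hmain : |HnormP W h p u - ∑' x, cv x * f (pos u x) * u x| ≤ e * B := by
    have hstep : ∀ S : Finset (Z d),
        |∑' x, gradNorm W u x ^ p + ∑ x ∈ S, h x * |u x| ^ p
          - ∑ x ∈ S, cv x * f (pos u x) * u x| ≤ e * B +
          CG * (∑' x, |u x| ^ p) ^ ((p - 1) / p) *
            (∑' x, |u x| ^ p - ∑ x ∈ S, |u x| ^ p) ^ (1 / p) := by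
      intro S
      obtain ⟨hc1, hc2⟩ := cut_norm (h := h) hp S u
      obtain ⟨hd1, hd2⟩ := cut_compl hp S hs
      have hcs : Summable fun x => |cut S u x| ^ p :=
        summ_fin (S := S) fun x hx => abs_rpow_zero hp (cut_not hx u)
      have hP := pairing_test hp hh0 ht (cut_supp S u) hB (by
        refine (hmem _ hc1).trans (le_trans ?_ hle)
        rw [hc2]
        refine mul_le_mul_of_nonneg_left ?_ hC1.le
        exact hhs.sum_le_tsum S fun x _ => mul_nonneg (hh0 x) (by positivity))
      rw [pairing_cut hK hp hs] at hP
      have hsub := gT_sub hK hp hs hs hcs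
      rw [gT_self hK hp] at hsub
      have hbd := (hg u _ hs hd1).2
      rw [hd2, hsub] at hbd
      have hsum : ∑ x ∈ S, h x * |u x| ^ (p - 2) * u x * u x = ∑ x ∈ S, h x * |u x| ^ p :=
        Finset.sum_congr rfl fun x _ => by rw [← abs_pow_split2 hp (u x)]; ring
      rw [hsum] at hP
      rw [abs_le] at hP hbd ⊢
      constructor <;> linarith [hP.1, hP.2, hbd.1, hbd.2]
    have hl : Tendsto (fun S : Finset (Z d) => |∑' x, gradNorm W u x ^ p
        + ∑ x ∈ S, h x * |u x| ^ p - ∑ x ∈ S, cv x * f (pos u x) * u x|) atTop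
        (𝓝 |HnormP W h p u - ∑' x, cv x * f (pos u x) * u x|) := by
      rw [hH]
      exact ((tendsto_const_nhds.add hhs.hasSum).sub hQs.hasSum).abs
    have hr : Tendsto (fun S : Finset (Z d) => e * B +
          CG * (∑' x, |u x| ^ p) ^ ((p - 1) / p) *
            (∑' x, |u x| ^ p - ∑ x ∈ S, |u x| ^ p) ^ (1 / p)) atTop (𝓝 (e * B)) := by
      have h1 : Tendsto (fun S : Finset (Z d) => ∑' x, |u x| ^ p - ∑ x ∈ S, |u x| ^ p) atTop
          (𝓝 (∑' x, |u x| ^ p - ∑' x, |u x| ^ p)) := tendsto_const_nhds.sub hs.hasSum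
      rw [sub_self] at h1
      have h2 := h1.rpow_const (p := 1 / p) (Or.inr (by positivity))
      rw [Real.zero_rpow (by positivity)] at h2
      have h3 := (h2.const_mul (CG * (∑' x, |u x| ^ p) ^ ((p - 1) / p))).const_add (e * B)
      simpa using h3
    exact le_of_tendsto_of_tendsto' hl hr hstep
  have hQ : ∑' x, cv x * f (pos u x) * u x ≤ HnormP W h p u + e * B := by
    rw [abs_le] at hmain; linarith [hmain.1]
  unfold energy
  have h1 : (1 / 2) * ∑' x, cv x * Fint f (pos u x) ≤ (HnormP W h p u + e * B) / θ := by
    calc _ ≤ (1 / 2) * ((2 / θ) * ∑' x, cv x * f (pos u x) * u x) := by gcongr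
      _ = (∑' x, cv x * f (pos u x) * u x) / θ := by ring
      _ ≤ _ := by gcongr
  rw [add_div] at h1
  have h2 : (1 / p - 1 / θ) * HnormP W h p u = 1 / p * HnormP W h p u - HnormP W h p u / θ := by
    ring
  linarith

/-- Palais–Smale sequences are bounded. -/
lemma ps_bound (hd : 0 < d) (hK : KB W K) (hp : 2 ≤ p) (hh₀ : 0 < h₀) (hh1 : ∀ x, h₀ ≤ h x)
    {α θ : ℝ} (hα : α ∈ Set.Ioo (0 : ℝ) (d : ℝ)) {f : ℝ → ℝ} (hfc : Continuous f)
    (hfz : ∀ t ≤ (0 : ℝ), f t = 0) (hf1 : F1 f p) (hθ : p < θ) (hf3 : F3 f θ) (J0 e0 : ℝ) :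
    ∃ M : ℝ, 0 < M ∧ ∀ (u : Z d → ℝ) (e : ℝ), memH W h p u → energy W h p α f u ≤ J0 →
      e ≤ e0 → (∀ φ : Z d → ℝ, (Function.support φ).Finite → normH W h p φ ≤ 1 →
      |pairing W h p α f u φ| ≤ e) → ∑' x, h x * |u x| ^ p ≤ M := by
  obtain ⟨C1, hC1, hm⟩ := memH_of (p := p) hK hp hh₀ hh1
  have hp0 : 0 < p := by linarith
  have hθ0 : 0 < θ := by linarith
  have hh0 : ∀ x, 0 ≤ h x := fun x => hh₀.le.trans (hh1 x)
  have ha : 0 < 1 / p - 1 / θ := by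
    have := one_div_lt_one_div_of_lt hp0 hθ
    linarith
  set a := 1 / p - 1 / θ with ha_def
  set E := |e0| / θ with hE
  have hE0 : 0 ≤ E := by positivity
  refine ⟨|(2 / a) * (J0 + E ^ 2 * C1 / (2 * a) + a / (2 * C1))| + 1, by positivity, ?_⟩
  intro u e hu hJ he ht
  have hhs := memH_summ hh₀ hh1 hu
  obtain ⟨hs, hgs, -, hH, -, -⟩ := hm u hhs
  obtain ⟨C, hC, hnl⟩ := nonlin hd hα hp hθ hfc hfz hf1 hf3 (∑' x, |u x| ^ p)
  have hN0 : 0 ≤ ∑' x, h x * |u x| ^ p := tsum_nonneg fun x => mul_nonneg (hh0 x) (by positivity)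
  have hG0 : 0 ≤ ∑' x, gradNorm W u x ^ p :=
    tsum_nonneg fun x => Real.rpow_nonneg (gradNorm_nonneg W u x) p
  set N := ∑' x, h x * |u x| ^ p with hN
  set B := (C1 * N + 1) ^ (1 / p) with hBdef
  have hCN : 0 ≤ C1 * N := by positivity
  have hB1 : 1 ≤ B := Real.one_le_rpow (by linarith) (by positivity)
  have hBp : B ^ p = C1 * N + 1 := by
    rw [hBdef, ← Real.rpow_mul (by positivity), one_div_mul_cancel hp0.ne', Real.rpow_one]
  have hB2 : B ^ 2 ≤ C1 * N + 1 := by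
    rw [← hBp, ← Real.rpow_natCast]
    exact Real.rpow_le_rpow_of_exponent_le hB1 (by exact_mod_cast hp)
  have key := ar_ineq hK hp hh0 hC1 (fun u hu => (hm u hu).2.2.2.2.2) hθ hC (hnl u hs le_rfl) hs
    hhs hH ht (by linarith : 0 < B) (by rw [hBp]; linarith)
  have h1 : a * N ≤ J0 + E * B := by
    have h2 : a * N ≤ a * HnormP W h p u := by
      rw [hH]; apply mul_le_mul_of_nonneg_left _ ha.le; linarith
    have h3 : e * B / θ ≤ E * B := by
      rw [hE, div_mul_eq_mul_div]
      gcongr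
      exact he.trans (le_abs_self _)
    linarith
  have h4 : E * B ≤ E ^ 2 * C1 / (2 * a) + a / (2 * C1) * B ^ 2 := by
    have : E ^ 2 * C1 / (2 * a) + a / (2 * C1) * B ^ 2 - E * B
        = (E * C1 - a * B) ^ 2 / (2 * a * C1) := by
      field_simp; ring
    have : 0 ≤ (E * C1 - a * B) ^ 2 / (2 * a * C1) := by positivity
    linarith
  have h5 : a / (2 * C1) * B ^ 2 ≤ a / 2 * N + a / (2 * C1) := by
    calc _ ≤ a / (2 * C1) * (C1 * N + 1) := by gcongr
      _ = _ := by field_simp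
  have h6 : a / 2 * N ≤ J0 + E ^ 2 * C1 / (2 * a) + a / (2 * C1) := by linarith
  have h7 : N ≤ (2 / a) * (J0 + E ^ 2 * C1 / (2 * a) + a / (2 * C1)) := by
    calc N = (2 / a) * (a / 2 * N) := by field_simp
      _ ≤ _ := by gcongr
  linarith [le_abs_self ((2 / a) * (J0 + E ^ 2 * C1 / (2 * a) + a / (2 * C1)))]

end PartE2

section PartF
variable {W : Z d → Z d → ℝ} {K p h₀ : ℝ} {h : Z d → ℝ}

lemma mono_ineq (hp : 2 ≤ p) (a b : ℝ) :
    |a - b| ^ p ≤ (2 ^ (p - 2) * 2) * ((|a| ^ (p - 2) * a - |b| ^ (p - 2) * b) * (a - b)) := by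
  have hq : 0 ≤ p - 2 := by linarith
  have h1 := abs_sub_rpow_le hq a b
  have h2 := abs_pow_split2 hp (a - b)
  rw [← h2]
  set A := |a| ^ (p - 2)
  set B := |b| ^ (p - 2)
  have h3 : 0 ≤ (A - B) * (a ^ 2 - b ^ 2) := by
    rcases le_total |a| |b| with h | h
    · have hA : A ≤ B := Real.rpow_le_rpow (abs_nonneg _) h hq
      have := sq_le_sq.2 h
      exact mul_nonneg_of_nonpos_of_nonpos (by linarith) (by linarith)
    · have hA : B ≤ A := Real.rpow_le_rpow (abs_nonneg _) h hq
      have := sq_le_sq.2 h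
      exact mul_nonneg (by linarith) (by linarith)
  have h4 : (A + B) * (a - b) ^ 2 ≤ 2 * ((A * a - B * b) * (a - b)) := by nlinarith
  have h5 : (0 : ℝ) < 2 ^ (p - 2) := by positivity
  calc |a - b| ^ (p - 2) * (a - b) * (a - b) = |a - b| ^ (p - 2) * (a - b) ^ 2 := by ring
    _ ≤ 2 ^ (p - 2) * (A + B) * (a - b) ^ 2 := by gcongr
    _ = 2 ^ (p - 2) * ((A + B) * (a - b) ^ 2) := by ring
    _ ≤ 2 ^ (p - 2) * (2 * ((A * a - B * b) * (a - b))) := by gcongr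
    _ = _ := by ring

lemma single_est (hd : 0 < d) (hK : KB W K) (hp : 2 ≤ p)
    {α θ : ℝ} (hα : α ∈ Set.Ioo (0 : ℝ) (d : ℝ)) {f : ℝ → ℝ} (hfc : Continuous f)
    (hfz : ∀ t ≤ (0 : ℝ), f t = 0) (hf1 : F1 f p) (hθ : p < θ) (hf3 : F3 f θ) (A : ℝ) :
    ∃ C : ℝ, 0 < C ∧ ∀ (u D : Z d → ℝ) (S : Finset (Z d)), (Summable fun x => |u x| ^ p) →
      ∑' x, |u x| ^ p ≤ A → (Summable fun x => |D x| ^ p) →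
      |pairing W h p α f u (cut S D) - ∑ x ∈ S, h x * |u x| ^ (p - 2) * u x * D x| ≤
        C * (∑' x, |D x| ^ p) ^ (1 / p) := by
  obtain ⟨CG, hCG, hg⟩ := gT_bound hK hp
  obtain ⟨C, hC, hnl⟩ := nonlin hd hα hp hθ hfc hfz hf1 hf3 A
  have hp0 : 0 < p := by linarith
  have hp1 : 0 ≤ (p - 1) / p := div_nonneg (by linarith) hp0.le
  refine ⟨(CG + C * C) * |A| ^ ((p - 1) / p) + 1, by positivity, ?_⟩
  intro u D S hu hA hD
  have hn := hnl u hu hA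
  have hu0 : 0 ≤ ∑' x, |u x| ^ p := tsum_nonneg fun x => by positivity
  have hD0 : 0 ≤ ∑' x, |D x| ^ p := tsum_nonneg fun x => by positivity
  have hcs : Summable fun x => |cut S D x| ^ p :=
    summ_fin (S := S) fun x hx => abs_rpow_zero hp (cut_not hx D)
  have hcle : ∑' x, |cut S D x| ^ p ≤ ∑' x, |D x| ^ p := by
    refine hcs.tsum_le_tsum (fun x => ?_) hD
    by_cases hx : x ∈ S
    · rw [cut_mem hx]
    · rw [abs_rpow_zero hp (cut_not hx D)]; positivity
  have hc0 : 0 ≤ ∑' x, |cut S D x| ^ p := tsum_nonneg fun x => by positivity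
  have hAA : ∑' x, |u x| ^ p ≤ |A| := hA.trans (le_abs_self _)
  set X := (∑' x, |D x| ^ p) ^ (1 / p) with hX
  have hX0 : 0 ≤ X := by positivity
  have h1 : |gT W p u (cut S D)| ≤ CG * |A| ^ ((p - 1) / p) * X := by
    refine (hg u _ hu hcs).2.trans ?_
    rw [hX]; gcongr
  have h2 : |∑ x ∈ S, conv d α (fun y => Fint f (pos u y)) x * f (pos u x) * D x| ≤
      C * C * (|A| ^ ((p - 1) / p) * X) := by
    obtain ⟨hs1, hs2⟩ := holder_pm1 (a := fun x => |u x|) (b := fun x => |D x|) hp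
      (fun x => abs_nonneg _) (fun x => abs_nonneg _) hu hD
    calc _ ≤ ∑ x ∈ S, |conv d α (fun y => Fint f (pos u y)) x * f (pos u x) * D x| :=
          Finset.abs_sum_le_sum_abs _ _
      _ ≤ ∑ x ∈ S, C * C * (|u x| ^ (p - 1) * |D x|) := by
          refine Finset.sum_le_sum fun x _ => ?_
          rw [abs_mul, abs_of_nonneg (mul_nonneg (hn.c0 x) (hn.f0 x))]
          have h1 := hn.c1 x
          have h2 := hn.f1 x
          have h3 := hn.f0 x
          calc _ ≤ C * (C * |u x| ^ (p - 1)) * |D x| := by gcongr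
            _ = _ := by ring
      _ = C * C * ∑ x ∈ S, |u x| ^ (p - 1) * |D x| := by rw [Finset.mul_sum]
      _ ≤ C * C * ∑' x, |u x| ^ (p - 1) * |D x| := by
          gcongr
          exact hs1.sum_le_tsum S fun x _ => by positivity
      _ ≤ C * C * ((∑' x, |u x| ^ p) ^ ((p - 1) / p) * X) := by gcongr
      _ ≤ _ := by gcongr
  rw [pairing_cut hK hp hu]
  rw [abs_le] at h1 h2 ⊢
  constructor <;> nlinarith [h1.1, h1.2, h2.1, h2.2]

lemma sub_summ (hp : 2 ≤ p) (hh0 : ∀ x, 0 ≤ h x) {u v : Z d → ℝ} {M : ℝ}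
    (hu : Summable fun x => h x * |u x| ^ p) (hv : Summable fun x => h x * |v x| ^ p)
    (hM : ∑' x, h x * |u x| ^ p ≤ M) (hM' : ∑' x, h x * |v x| ^ p ≤ M) :
    (Summable fun x => h x * |u x - v x| ^ p) ∧
      ∑' x, h x * |u x - v x| ^ p ≤ 2 ^ p * (M + M) := by
  have hle : ∀ x, h x * |u x - v x| ^ p ≤ 2 ^ p * (h x * |u x| ^ p + h x * |v x| ^ p) := by
    intro x
    calc _ ≤ h x * (2 ^ p * (|u x| ^ p + |v x| ^ p)) :=
          mul_le_mul_of_nonneg_left (abs_sub_rpow_le (by linarith) _ _) (hh0 x)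
      _ = _ := by ring
  have hs := (hu.add hv).mul_left ((2 : ℝ) ^ p)
  have hs1 : Summable fun x => h x * |u x - v x| ^ p :=
    Summable.of_nonneg_of_le (fun x => mul_nonneg (hh0 x) (by positivity)) hle hs
  refine ⟨hs1, (hs1.tsum_le_tsum hle hs).trans ?_⟩
  rw [tsum_mul_left, hu.tsum_add hv]
  gcongr

lemma diff_est (hd : 0 < d) (hK : KB W K) (hp : 2 ≤ p) (hh₀ : 0 < h₀) (hh1 : ∀ x, h₀ ≤ h x)
    {α θ : ℝ} (hα : α ∈ Set.Ioo (0 : ℝ) (d : ℝ)) {f : ℝ → ℝ} (hfc : Continuous f)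
    (hfz : ∀ t ≤ (0 : ℝ), f t = 0) (hf1 : F1 f p) (hθ : p < θ) (hf3 : F3 f θ) {M : ℝ}
    (hM : 0 < M) :
    ∃ C : ℝ, 0 < C ∧ ∀ (u v : Z d → ℝ) (e e' : ℝ),
      (Summable fun x => h x * |u x| ^ p) → (Summable fun x => h x * |v x| ^ p) →
      ∑' x, h x * |u x| ^ p ≤ M → ∑' x, h x * |v x| ^ p ≤ M →
      (∀ φ : Z d → ℝ, (Function.support φ).Finite → normH W h p φ ≤ 1 →
      |pairing W h p α f u φ| ≤ e) →
      (∀ φ : Z d → ℝ, (Function.support φ).Finite → normH W h p φ ≤ 1 →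
      |pairing W h p α f v φ| ≤ e') → ∀ S : Finset (Z d),
      ∑ x ∈ S, h x * |u x - v x| ^ p ≤
        C * (e + e' + (∑' x, |u x - v x| ^ p) ^ (1 / p)) := by
  have hp0 : 0 < p := by linarith
  have hh0 : ∀ x, 0 ≤ h x := fun x => hh₀.le.trans (hh1 x)
  obtain ⟨C1, hC1, hm⟩ := memH_of (p := p) hK hp hh₀ hh1
  obtain ⟨C2, hC2, hse⟩ := single_est (h := h) hd hK hp hα hfc hfz hf1 hθ hf3 (M / h₀)
  set B := (C1 * (2 ^ p * (M + M))) ^ (1 / p) with hB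
  have hB0 : 0 < B := by positivity
  have hBp : B ^ p = C1 * (2 ^ p * (M + M)) := by
    rw [hB, ← Real.rpow_mul (by positivity), one_div_mul_cancel hp0.ne', Real.rpow_one]
  have hc : (0 : ℝ) < 2 ^ (p - 2) * 2 := by positivity
  refine ⟨(2 ^ (p - 2) * 2) * (B + 2 * C2), by positivity, ?_⟩
  intro u v e e' hu hv huM hvM htu htv S
  obtain ⟨hD, hDM⟩ := sub_summ hp hh0 hu hv huM hvM
  have hDs := (hm _ hD).1
  obtain ⟨hus, -, hu2, -⟩ := hm u hu
  obtain ⟨hvs, -, hv2, -⟩ := hm v hv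
  have huA : ∑' x, |u x| ^ p ≤ M / h₀ := by rw [le_div_iff₀ hh₀]; linarith
  have hvA : ∑' x, |v x| ^ p ≤ M / h₀ := by rw [le_div_iff₀ hh₀]; linarith
  have e0 : 0 ≤ e := (abs_nonneg _).trans (htu (fun _ => 0) (by simp) (by
    have : HnormP W h p (fun _ : Z d => (0 : ℝ)) = 0 := by
      have := HnormP_smul (W := W) (h := h) (p := p) (fun _ => 0) 0
      rw [abs_zero, Real.zero_rpow hp0.ne', zero_mul] at this
      simpa using this
    unfold normH; rw [this, Real.zero_rpow (by positivity)]; norm_num))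
  have e0' : 0 ≤ e' := (abs_nonneg _).trans (htv (fun _ => 0) (by simp) (by
    have : HnormP W h p (fun _ : Z d => (0 : ℝ)) = 0 := by
      have := HnormP_smul (W := W) (h := h) (p := p) (fun _ => 0) 0
      rw [abs_zero, Real.zero_rpow hp0.ne', zero_mul] at this
      simpa using this
    unfold normH; rw [this, Real.zero_rpow (by positivity)]; norm_num))
  set D : Z d → ℝ := fun x => u x - v x with hDdef
  obtain ⟨hc1, hc2⟩ := cut_norm (h := h) hp S D
  have hcut : HnormP W h p (cut S D) ≤ B ^ p := by
    refine ((hm _ hc1).2.2.2.2.2).trans ?_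
    rw [hBp, hc2]
    refine mul_le_mul_of_nonneg_left (le_trans ?_ hDM) hC1.le
    exact hD.sum_le_tsum S fun x _ => mul_nonneg (hh0 x) (by positivity)
  have p1 := pairing_test hp hh0 htu (cut_supp S D) hB0 hcut
  have p2 := pairing_test hp hh0 htv (cut_supp S D) hB0 hcut
  have s1 := hse u D S hus huA hDs
  have s2 := hse v D S hvs hvA hDs
  have hsum : ∑ x ∈ S, h x * |u x - v x| ^ p ≤ (2 ^ (p - 2) * 2) *
      (∑ x ∈ S, h x * |u x| ^ (p - 2) * u x * D x
        - ∑ x ∈ S, h x * |v x| ^ (p - 2) * v x * D x) := by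
    rw [← Finset.sum_sub_distrib, Finset.mul_sum]
    refine Finset.sum_le_sum fun x _ => ?_
    calc _ ≤ h x * _ := mul_le_mul_of_nonneg_left (mono_ineq hp (u x) (v x)) (hh0 x)
      _ = _ := by rw [hDdef]; ring
  refine hsum.trans ?_
  rw [mul_assoc _ (B + 2 * C2)]
  refine mul_le_mul_of_nonneg_left ?_ hc.le
  have hX0 : 0 ≤ (∑' x, |D x| ^ p) ^ (1 / p) :=
    Real.rpow_nonneg (tsum_nonneg fun x => by positivity) _
  set X := (∑' x, |D x| ^ p) ^ (1 / p)
  rw [abs_le] at p1 p2 s1 s2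
  have : (B + 2 * C2) * (e + e' + X) =
      e * B + e' * B + 2 * (C2 * X) + (B * X + 2 * C2 * (e + e')) := by ring
  have : 0 ≤ B * X + 2 * C2 * (e + e') := by positivity
  linarith [p1.1, p1.2, p2.1, p2.2, s1.1, s1.2, s2.1, s2.2]

lemma lp_cauchy (hp : 2 ≤ p) (hh0 : ∀ x, 0 ≤ h x) (hh2 : H2 h) {M : ℝ} (hM : 0 < M)
    {w : ℕ → Z d → ℝ} {v : Z d → ℝ} (hw : ∀ n, Summable fun x => h x * |w n x| ^ p)
    (hwM : ∀ n, ∑' x, h x * |w n x| ^ p ≤ M)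
    (hs : ∀ n m, Summable fun x => |w n x - w m x| ^ p)
    (hv : ∀ x, Tendsto (fun n => w n x) atTop (𝓝 (v x))) {η : ℝ} (hη : 0 < η) :
    ∃ N0, ∀ n m, N0 ≤ n → N0 ≤ m → ∑' x, |w n x - w m x| ^ p ≤ η := by
  have hp0 : 0 < p := by linarith
  set L := 2 ^ p * (M + M) / (η / 2) with hL
  have hL0 : 0 < L := by positivity
  have hfin : {x | ¬ L ≤ h x}.Finite := hh2.eventually_ge_atTop L
  set T := hfin.toFinset with hT
  have hlim : Tendsto (fun q : ℕ × ℕ => ∑ x ∈ T, |w q.1 x - w q.2 x| ^ p) atTop (𝓝 0) := by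
    have : (0 : ℝ) = ∑ x ∈ T, |v x - v x| ^ p := by
      symm; exact Finset.sum_eq_zero fun x _ => abs_rpow_zero hp (sub_self _)
    rw [this, ← prod_atTop_atTop_eq]
    refine tendsto_finsetSum _ fun x _ => ?_
    exact ((((hv x).comp tendsto_fst).sub ((hv x).comp tendsto_snd)).abs).rpow_const
      (Or.inr hp0.le)
  obtain ⟨⟨a, b⟩, hab⟩ := eventually_atTop.1 (hlim.eventually_lt_const (half_pos hη))
  refine ⟨max a b, fun n m hn hm => ?_⟩
  have h1 := hab (n, m) ⟨(le_max_left a b).trans hn, (le_max_right a b).trans hm⟩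
  simp only at h1
  obtain ⟨hD, hDM⟩ := sub_summ hp hh0 (hw n) (hw m) (hwM n) (hwM m)
  set D : Z d → ℝ := fun x => w n x - w m x with hDdef
  have h0 : ∀ x, x ∉ T → |cut T D x| ^ p = 0 := fun x hx => abs_rpow_zero hp (cut_not hx D)
  have hle : ∀ x, |D x| ^ p ≤ |cut T D x| ^ p + L⁻¹ * (h x * |D x| ^ p) := by
    intro x
    by_cases hx : x ∈ T
    · rw [cut_mem hx]
      have : 0 ≤ L⁻¹ * (h x * |D x| ^ p) :=
        mul_nonneg (by positivity) (mul_nonneg (hh0 x) (by positivity))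
      linarith
    · rw [h0 x hx, zero_add]
      have hx' : L ≤ h x := by
        by_contra hcon
        exact hx (by rw [hT, Set.Finite.mem_toFinset]; exact hcon)
      rw [le_inv_mul_iff₀ hL0]
      gcongr
  calc ∑' x, |D x| ^ p ≤ ∑' x, (|cut T D x| ^ p + L⁻¹ * (h x * |D x| ^ p)) :=
        (hs n m).tsum_le_tsum hle ((summ_fin h0).add (hD.mul_left _))
    _ = ∑ x ∈ T, |D x| ^ p + L⁻¹ * ∑' x, h x * |D x| ^ p := by
        rw [(summ_fin h0).tsum_add (hD.mul_left _), tsum_mul_left, tsum_eq_sum h0]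
        congr 1
        exact Finset.sum_congr rfl fun x hx => by rw [cut_mem hx]
    _ ≤ η / 2 + L⁻¹ * (2 ^ p * (M + M)) := by gcongr
    _ = η := by rw [hL]; field_simp; ring

end PartF

theorem palais_smale_condition
    {d : ℕ} (hd : 0 < d) {s p : ℝ} (hs : s ∈ Set.Ioo (0 : ℝ) 1) (hp : 2 ≤ p)
    {W : Z d → Z d → ℝ} (hW : KernelOK d s W)
    {α : ℝ} (hα : α ∈ Set.Ioo (0 : ℝ) (d : ℝ))
    {h : Z d → ℝ} {h₀ : ℝ} (hh₀ : 0 < h₀) (hh1 : ∀ x, h₀ ≤ h x)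
    (hh2 : H2 h)
    {f : ℝ → ℝ} (hfc : Continuous f) (hfz : ∀ t ≤ (0 : ℝ), f t = 0)
    (hf1 : F1 f p)
    {C₀ τ : ℝ} (hC₀ : 0 < C₀) (hτ : ((d : ℝ) + α) * p / (2 * d) < τ)
    (hf2 : ∀ t > (0 : ℝ), f t ≤ C₀ * (1 + t ^ (τ - 1)))
    {θ : ℝ} (hθ : p < θ) (hf3 : F3 f θ)
    (c₀ : ℝ) (u : ℕ → Z d → ℝ) (hmem : ∀ n, memH W h p (u n))
    (hJ : Tendsto (fun n => energy W h p α f (u n)) atTop (nhds c₀))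
    (ε : ℕ → ℝ) (hε : Tendsto ε atTop (nhds 0))
    (hJ' : ∀ n, ∀ φ : Z d → ℝ, (Function.support φ).Finite → normH W h p φ ≤ 1 →
      |pairing W h p α f (u n) φ| ≤ ε n) :
    ∃ φs : ℕ → ℕ, StrictMono φs ∧ ∃ v : Z d → ℝ, memH W h p v ∧
      Tendsto (fun k => normH W h p (fun x => u (φs k) x - v x)) atTop (nhds 0) := by
  have hp0 : 0 < p := by linarith
  have hh0 : ∀ x, 0 ≤ h x := fun x => hh₀.le.trans (hh1 x)
  obtain ⟨k1, k2, K, k3, k4⟩ := kernel_bound hd hs.1 hW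
  have hK : KB W K := ⟨k1, k2, k3, fun x => (k4 x).1, fun x => (k4 x).2⟩
  obtain ⟨J0, hJ0⟩ := hJ.bddAbove_range
  obtain ⟨e0, he0⟩ := hε.bddAbove_range
  obtain ⟨M, hM, hMb⟩ := ps_bound (W := W) (h := h) hd hK hp hh₀ hh1 hα hfc hfz hf1 hθ hf3 J0 e0
  have hN : ∀ n, ∑' x, h x * |u n x| ^ p ≤ M := fun n =>
    hMb (u n) (ε n) (hmem n) (hJ0 ⟨n, rfl⟩) (he0 ⟨n, rfl⟩) (hJ' n)
  have hS : ∀ n, Summable fun x => h x * |u n x| ^ p := fun n => memH_summ hh₀ hh1 (hmem n)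
  obtain ⟨C1, hC1, hm⟩ := memH_of (p := p) hK hp hh₀ hh1
  have hbd : ∀ n x, |u n x| ≤ (M / h₀) ^ (1 / p) := fun n x => by
    obtain ⟨h1, -, h2, -⟩ := hm (u n) (hS n)
    refine abs_le_of_tsum hp h1 ?_ x
    rw [le_div_iff₀ hh₀]; linarith [hN n]
  have hcomp : IsCompact (Set.univ.pi fun _ : Z d =>
      Set.Icc (-(M / h₀) ^ (1 / p)) ((M / h₀) ^ (1 / p))) :=
    isCompact_univ_pi fun _ => isCompact_Icc
  obtain ⟨v, -, φs, hφs, hlim⟩ := hcomp.tendsto_subseq (x := u)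
    (fun n x _ => abs_le.1 (hbd n x))
  have hv : ∀ x, Tendsto (fun n => u (φs n) x) atTop (𝓝 (v x)) := tendsto_pi_nhds.1 hlim
  have hεs : Tendsto (fun n => ε (φs n)) atTop (𝓝 0) := hε.comp hφs.tendsto_atTop
  obtain ⟨C, hC, hest⟩ := diff_est (W := W) hd hK hp hh₀ hh1 hα hfc hfz hf1 hθ hf3 hM
  -- the limit belongs to the weighted space
  have hvS : Summable fun x => h x * |v x| ^ p := by
    refine summable_of_sum_le (c := M) (fun x => mul_nonneg (hh0 x) (by positivity)) fun S => ?_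
    have ht : Tendsto (fun n => ∑ x ∈ S, h x * |u (φs n) x| ^ p) atTop
        (𝓝 (∑ x ∈ S, h x * |v x| ^ p)) :=
      tendsto_finsetSum _ fun x _ => (((hv x).abs).rpow_const (Or.inr hp0.le)).const_mul _
    refine le_of_tendsto' ht fun n => ?_
    exact ((hS _).sum_le_tsum S fun x _ => mul_nonneg (hh0 x) (by positivity)).trans (hN _)
  -- Cauchy estimate
  have hcau : ∀ δ > 0, ∃ N0, ∀ n, N0 ≤ n → (Summable fun x => h x * |u (φs n) x - v x| ^ p) ∧
      ∑' x, h x * |u (φs n) x - v x| ^ p ≤ δ := by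
    intro δ hδ
    set r := δ / (3 * C) with hr
    have hr0 : 0 < r := by positivity
    obtain ⟨N1, hN1⟩ := lp_cauchy hp hh0 hh2 hM (w := fun n => u (φs n)) (v := v)
      (fun n => hS _) (fun n => hN _)
      (fun n m => (hm _ (sub_summ hp hh0 (hS _) (hS _) (hN _) (hN _)).1).1) hv
      (η := r ^ p) (by positivity)
    obtain ⟨N2, hN2⟩ := eventually_atTop.1 (hεs.eventually_lt_const hr0)
    refine ⟨max N1 N2, fun n hn => ?_⟩
    have hfin : ∀ S : Finset (Z d), ∑ x ∈ S, h x * |u (φs n) x - v x| ^ p ≤ δ := by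
      intro S
      have ht : Tendsto (fun m => ∑ x ∈ S, h x * |u (φs n) x - u (φs m) x| ^ p) atTop
          (𝓝 (∑ x ∈ S, h x * |u (φs n) x - v x| ^ p)) :=
        tendsto_finsetSum _ fun x _ =>
          (((tendsto_const_nhds.sub (hv x)).abs).rpow_const (Or.inr hp0.le)).const_mul _
      refine le_of_tendsto ht ?_
      filter_upwards [eventually_ge_atTop (max N1 N2)] with m hmm
      refine (hest _ _ _ _ (hS _) (hS _) (hN _) (hN _) (hJ' _) (hJ' _) S).trans ?_
      have a1 := hN1 n m ((le_max_left _ _).trans hn) ((le_max_left _ _).trans hmm)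
      have a2 := hN2 n ((le_max_right _ _).trans hn)
      have a3 := hN2 m ((le_max_right _ _).trans hmm)
      have a4 : (∑' x, |u (φs n) x - u (φs m) x| ^ p) ^ (1 / p) ≤ r := by
        calc _ ≤ (r ^ p) ^ (1 / p) :=
              Real.rpow_le_rpow (tsum_nonneg fun x => by positivity) a1 (by positivity)
          _ = r := by
              rw [← Real.rpow_mul hr0.le, mul_one_div_cancel hp0.ne', Real.rpow_one]
      calc _ ≤ C * (r + r + r) := by gcongr
        _ = δ := by rw [hr]; field_simp; ring
    have hsm : Summable fun x => h x * |u (φs n) x - v x| ^ p :=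
      summable_of_sum_le (fun x => mul_nonneg (hh0 x) (by positivity)) hfin
    exact ⟨hsm, hsm.tsum_le_of_sum_le hfin⟩
  refine ⟨φs, hφs, v, (hm v hvS).2.2.2.2.1, ?_⟩
  have hHP : Tendsto (fun k => HnormP W h p (fun x => u (φs k) x - v x)) atTop (𝓝 0) := by
    rw [Metric.tendsto_atTop]
    intro δ hδ
    obtain ⟨N0, hN0⟩ := hcau (δ / (2 * C1)) (by positivity)
    refine ⟨N0, fun n hn => ?_⟩
    obtain ⟨a1, a2⟩ := hN0 n hn
    have a3 := (hm _ a1).2.2.2.2.2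
    have a4 : 0 ≤ HnormP W h p (fun x => u (φs n) x - v x) := tsum_nonneg fun x =>
      add_nonneg (Real.rpow_nonneg (gradNorm_nonneg W _ x) p)
        (mul_nonneg (hh0 x) (by positivity))
    rw [Real.dist_eq, sub_zero, abs_of_nonneg a4]
    calc _ ≤ C1 * (δ / (2 * C1)) := a3.trans (by gcongr)
      _ = δ / 2 := by field_simp
      _ < δ := by linarith
  have := hHP.rpow_const (p := 1 / p) (Or.inr (by positivity))
  rw [Real.zero_rpow (by positivity)] at this
  exact this

end DiscreteChoquard
end
end

section
/- Assume (h1) and (f1)–(f3). Then every u in the Nehari set M satisfies J̃(u) ≥ (1/p − 1/θ)·‖u‖_{H_{s,p}}^p > 0. -/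
open MeasureTheory Filter Topology
open scoped ENNReal

noncomputable section

namespace DiscreteChoquard

variable {d : ℕ}

lemma box_integrable {g : (Fin d → ℝ) → ℝ} (hg : Continuous g) :
    Integrable g (volume.restrict (box d)) := by
  have hc : IsCompact (box d) := isCompact_univ_pi fun _ => isCompact_Icc
  exact hg.continuousOn.integrableOn_compact hc

lemma exp_integral (n : ℤ) :
    ∃ r : ℝ, 0 ≤ r ∧
      ∫ t in Set.Icc (0 : ℝ) (2 * Real.pi), Complex.exp (((n : ℝ) * t : ℝ) * Complex.I) = (r : ℂ) := by
  have hpi : (0 : ℝ) ≤ 2 * Real.pi := by positivity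
  rw [integral_Icc_eq_integral_Ioc, ← intervalIntegral.integral_of_le hpi]
  by_cases hn : n = 0
  · refine ⟨2 * Real.pi, hpi, ?_⟩
    subst hn
    simp
  · refine ⟨0, le_rfl, ?_⟩
    have hc : ((n : ℂ) * Complex.I) ≠ 0 := by
      simp [hn]
    have h1 := integral_exp_mul_complex (a := 0) (b := 2 * Real.pi) hc
    have h2 : Complex.exp ((n : ℂ) * Complex.I * ((2 * Real.pi : ℝ) : ℂ)) = 1 := by
      rw [Complex.exp_eq_one_iff]
      exact ⟨n, by push_cast; ring⟩
    rw [h2] at h1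
    simp only [Complex.ofReal_zero, mul_zero, Complex.exp_zero, sub_self, zero_div] at h1
    rw [Complex.ofReal_zero, ← h1]
    congr 1
    ext t
    congr 1
    push_cast
    ring

lemma base_nonneg_s14 (n : Fin d → ℤ) :
    0 ≤ ∫ k in box d, Real.cos (∑ j, (n j : ℝ) * k j) := by
  have h0 : ∀ k : Fin d → ℝ, Real.cos (∑ j, (n j : ℝ) * k j) =
      RCLike.re (∏ j, Complex.exp (((n j : ℝ) * k j : ℝ) * Complex.I)) := by
    intro k
    rw [← Complex.exp_sum, ← Finset.sum_mul, ← Complex.ofReal_sum]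
    exact (Complex.exp_ofReal_mul_I_re _).symm
  simp_rw [h0]
  have hc : IsCompact (box d) := isCompact_univ_pi fun _ => isCompact_Icc
  have hint : Integrable (fun k : Fin d → ℝ =>
      ∏ j, Complex.exp (((n j : ℝ) * k j : ℝ) * Complex.I)) (volume.restrict (box d)) := by
    exact (Continuous.continuousOn (by fun_prop)).integrableOn_compact hc
  rw [integral_re hint]
  have hr : (volume : Measure (Fin d → ℝ)).restrict (box d) =
      Measure.pi fun _ => volume.restrict (Set.Icc (0 : ℝ) (2 * Real.pi)) := by
    rw [volume_pi, box, Measure.restrict_pi_pi]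
  rw [hr, integral_fintype_prod_eq_prod
    (f := fun j (t : ℝ) => Complex.exp (((n j : ℝ) * t : ℝ) * Complex.I))]
  choose r hr0 hr1 using exp_integral
  simp_rw [hr1]
  rw [← Complex.ofReal_prod]
  simp only [RCLike.re_to_complex, Complex.ofReal_re]
  exact Finset.prod_nonneg fun j _ => hr0 _

lemma pow_nonneg' (m : ℕ) : ∀ n : Fin d → ℤ,
    0 ≤ ∫ k in box d, Real.cos (∑ j, (n j : ℝ) * k j) * (∑ j, Real.cos (k j)) ^ m := by
  induction m with
  | zero => intro n; simpa using base_nonneg_s14 n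
  | succ m ih =>
    intro n
    have h : ∀ k : Fin d → ℝ,
        Real.cos (∑ j, (n j : ℝ) * k j) * (∑ j, Real.cos (k j)) ^ (m + 1) =
        ∑ i, (1 / 2) * (Real.cos (∑ j, (((n + Pi.single i 1 : Fin d → ℤ) j : ℤ) : ℝ) * k j)
            * (∑ j, Real.cos (k j)) ^ m +
          Real.cos (∑ j, (((n - Pi.single i 1 : Fin d → ℤ) j : ℤ) : ℝ) * k j) * (∑ j, Real.cos (k j)) ^ m) := by
      intro k
      have h1 : ∀ i, ∑ j, (((n + Pi.single i 1 : Fin d → ℤ) j : ℤ) : ℝ) * k j = (∑ j, (n j : ℝ) * k j) + k i := by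
        intro i
        simp [add_mul, Finset.sum_add_distrib, Pi.single_apply]
      have h2 : ∀ i, ∑ j, (((n - Pi.single i 1 : Fin d → ℤ) j : ℤ) : ℝ) * k j = (∑ j, (n j : ℝ) * k j) - k i := by
        intro i
        simp [sub_mul, Finset.sum_sub_distrib, Pi.single_apply]
      rw [pow_succ', ← mul_assoc, Finset.mul_sum, Finset.sum_mul]
      refine Finset.sum_congr rfl fun i _ => ?_
      rw [h1, h2, Real.cos_add, Real.cos_sub]
      ring
    simp_rw [h]
    rw [integral_finsetSum]
    · refine Finset.sum_nonneg fun i _ => ?_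
      rw [integral_const_mul, integral_add]
      · have := ih (n + Pi.single i 1)
        have := ih (n - Pi.single i 1)
        positivity
      · exact box_integrable (by fun_prop)
      · exact box_integrable (by fun_prop)
    · intro i _
      exact box_integrable (by fun_prop)

lemma coef_nonneg {b : ℝ} (hb : 0 < b) (n : ℕ) : 0 ≤ Ring.choose (b + n - 1) n := by
  rw [← Ring.multichoose_eq]
  have h := Ring.factorial_nsmul_multichoose_eq_ascPochhammer b n
  rw [Polynomial.ascPochhammer_smeval_eq_eval] at h
  have h2 := ascPochhammer_pos n b hb
  rw [← h, nsmul_eq_mul] at h2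
  exact (pos_of_mul_pos_right h2 (by positivity)).le

lemma coef_hasSum (b : ℝ) {x : ℝ} (hx : |x| < 1) :
    HasSum (fun n : ℕ => Ring.choose (b + n - 1) n * x ^ n) ((1 - x) ^ (-b)) := by
  have h := (Real.one_div_one_sub_rpow_hasFPowerSeriesOnBall_zero b).hasSum (y := x) (by
    simp [Metric.mem_eball, edist_zero_right]
    rw [← ofReal_norm]
    simpa using hx)
  have hx1 : 0 ≤ 1 - x := by linarith [le_abs_self x]
  simp only [FormalMultilinearSeries.ofScalars_apply_eq, smul_eq_mul, zero_add] at h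
  rwa [Real.rpow_neg hx1, ← one_div]

lemma P_le (k : Fin d → ℝ) : |(∑ j, Real.cos (k j)) / d| ≤ 1 := by
  rw [abs_div, Nat.abs_cast]
  refine div_le_one_of_le₀ ?_ (by positivity)
  calc |∑ j, Real.cos (k j)| ≤ ∑ j, |Real.cos (k j)| := Finset.abs_sum_le_sum_abs _ _
    _ ≤ ∑ j : Fin d, (1 : ℝ) := Finset.sum_le_sum fun j _ => Real.abs_cos_le_one _
    _ = d := by simp

lemma reg_nonneg (n : Fin d → ℤ) {b r : ℝ} (hb : 0 < b) (hr0 : 0 ≤ r) (hr1 : r < 1) :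
    0 ≤ ∫ k in box d, Real.cos (∑ j, (n j : ℝ) * k j) *
      (1 - r * ((∑ j, Real.cos (k j)) / d)) ^ (-b) := by
  have hc : IsCompact (box d) := isCompact_univ_pi fun _ => isCompact_Icc
  have hfin : IsFiniteMeasure ((volume : Measure (Fin d → ℝ)).restrict (box d)) :=
    ⟨by simpa using hc.measure_lt_top⟩
  have hs := hasSum_integral_of_dominated_convergence (μ := volume.restrict (box d))
    (F := fun (m : ℕ) (k : Fin d → ℝ) => Real.cos (∑ j, (n j : ℝ) * k j) *
      (Ring.choose (b + m - 1) m * (r * ((∑ j, Real.cos (k j)) / d)) ^ m))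
    (f := fun k => Real.cos (∑ j, (n j : ℝ) * k j) *
      (1 - r * ((∑ j, Real.cos (k j)) / d)) ^ (-b))
    (fun m _ => Ring.choose (b + m - 1) m * r ^ m)
    (fun m => (box_integrable (by fun_prop)).aestronglyMeasurable)
    (fun m => Eventually.of_forall fun k => by
      rw [norm_mul, norm_mul, Real.norm_eq_abs, Real.norm_eq_abs, abs_of_nonneg (coef_nonneg hb m),
        norm_pow, norm_mul, Real.norm_eq_abs, Real.norm_eq_abs, abs_of_nonneg hr0]
      have h1 := Real.abs_cos_le_one (∑ j, (n j : ℝ) * k j)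
      have h2 := coef_nonneg hb m
      have h3 : r * |(∑ j, Real.cos (k j)) / d| ≤ r := mul_le_of_le_one_right hr0 (P_le k)
      have h4 : (r * |(∑ j, Real.cos (k j)) / d|) ^ m ≤ r ^ m :=
        pow_le_pow_left₀ (by positivity) h3 m
      calc _ ≤ 1 * (Ring.choose (b + m - 1) m * r ^ m) := by gcongr
        _ = _ := one_mul _)
    (Eventually.of_forall fun k => (coef_hasSum b (by rwa [abs_of_nonneg hr0])).summable)
    (integrable_const _)
    (Eventually.of_forall fun k => (coef_hasSum b (by
      rw [abs_mul, abs_of_nonneg hr0]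
      exact (mul_le_of_le_one_right hr0 (P_le k)).trans_lt hr1)).mul_left _)
  refine hs.nonneg fun m => ?_
  have : ∀ k : Fin d → ℝ, Real.cos (∑ j, (n j : ℝ) * k j) *
      (Ring.choose (b + m - 1) m * (r * ((∑ j, Real.cos (k j)) / d)) ^ m) =
      (Ring.choose (b + m - 1) m * (r / d) ^ m) *
        (Real.cos (∑ j, (n j : ℝ) * k j) * (∑ j, Real.cos (k j)) ^ m) := by
    intro k
    rw [show r * ((∑ j, Real.cos (k j)) / d) = (r / d) * ∑ j, Real.cos (k j) by ring, mul_pow]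
    ring
  simp_rw [this]
  rw [integral_const_mul]
  exact mul_nonneg (mul_nonneg (coef_nonneg hb m) (by positivity)) (pow_nonneg' m n)

lemma ae_P_lt (hd : 0 < d) :
    ∀ᵐ k ∂((volume : Measure (Fin d → ℝ)).restrict (box d)), (∑ j, Real.cos (k j)) / d < 1 := by
  have hm : MeasurableSet (box d) := MeasurableSet.univ_pi fun _ => measurableSet_Icc
  rw [ae_restrict_iff' hm]
  have a1 := Measure.ae_eval_ne (μ := fun _ : Fin d => (volume : Measure ℝ)) ⟨0, hd⟩ 0
  have a2 := Measure.ae_eval_ne (μ := fun _ : Fin d => (volume : Measure ℝ)) ⟨0, hd⟩ (2 * Real.pi)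
  rw [volume_pi]
  filter_upwards [a1, a2] with k h1 h2 hk
  have hk0 := hk ⟨0, hd⟩ (Set.mem_univ _)
  have hlt : ∑ j, Real.cos (k j) < ∑ j : Fin d, (1 : ℝ) := by
    refine Finset.sum_lt_sum (fun j _ => Real.cos_le_one _) ⟨⟨0, hd⟩, Finset.mem_univ _, ?_⟩
    refine lt_of_le_of_ne (Real.cos_le_one _) fun he => ?_
    obtain ⟨z, hz⟩ := (Real.cos_eq_one_iff _).1 he
    have hp := Real.pi_pos
    have g0 : 0 < k ⟨0, hd⟩ := lt_of_le_of_ne hk0.1 (Ne.symm h1)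
    have g1 : k ⟨0, hd⟩ < 2 * Real.pi := lt_of_le_of_ne hk0.2 h2
    rw [← hz] at g0 g1
    have z0 : (0 : ℝ) < z := by
      by_contra hcon
      push Not at hcon
      nlinarith
    have z1 : (z : ℝ) < 1 := by
      by_contra hcon
      push Not at hcon
      nlinarith
    have z0' : 0 < z := by exact_mod_cast z0
    have z1' : z < 1 := by exact_mod_cast z1
    omega
  have hd' : (0 : ℝ) < d := by exact_mod_cast hd
  rw [div_lt_one hd']
  simpa using hlt

lemma lim_nonneg (hd : 0 < d) (n : Fin d → ℤ) {b : ℝ} (hb : 0 < b) :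
    0 ≤ ∫ k in box d, Real.cos (∑ j, (n j : ℝ) * k j) *
      (1 - (∑ j, Real.cos (k j)) / d) ^ (-b) := by
  by_cases hint : Integrable (fun k : Fin d → ℝ => Real.cos (∑ j, (n j : ℝ) * k j) *
      (1 - (∑ j, Real.cos (k j)) / d) ^ (-b)) (volume.restrict (box d))
  swap
  · rw [integral_undef hint]
  have hev : ∀ᶠ r in 𝓝[<] (1 : ℝ), 0 ≤ r ∧ r < 1 := by
    filter_upwards [Ioo_mem_nhdsLT (show (0 : ℝ) < 1 by norm_num)] with r hr
    exact ⟨hr.1.le, hr.2⟩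
  have ht := tendsto_integral_filter_of_dominated_convergence (μ := volume.restrict (box d))
    (l := 𝓝[<] (1 : ℝ))
    (F := fun (r : ℝ) (k : Fin d → ℝ) => Real.cos (∑ j, (n j : ℝ) * k j) *
      (1 - r * ((∑ j, Real.cos (k j)) / d)) ^ (-b))
    (f := fun k => Real.cos (∑ j, (n j : ℝ) * k j) * (1 - (∑ j, Real.cos (k j)) / d) ^ (-b))
    (fun k => (1 / 2 : ℝ) ^ (-b) * ‖Real.cos (∑ j, (n j : ℝ) * k j) *
      (1 - (∑ j, Real.cos (k j)) / d) ^ (-b)‖)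
    (Eventually.of_forall fun r => by
      apply Measurable.aestronglyMeasurable
      fun_prop)
    (by
      filter_upwards [hev] with r hr
      filter_upwards [ae_P_lt hd] with k hk
      have hP := abs_le.1 (P_le k)
      set P := (∑ j, Real.cos (k j)) / (d : ℝ)
      rw [norm_mul, norm_mul, mul_left_comm]
      refine mul_le_mul_of_nonneg_left ?_ (norm_nonneg _)
      have e1 : 0 < 1 - P := by linarith
      have e2 : (1 / 2) * (1 - P) ≤ 1 - r * P := by nlinarith [hr.1, hr.2]
      have e3 : 0 < 1 - r * P := by linarith
      rw [Real.norm_of_nonneg (Real.rpow_nonneg e3.le _),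
        Real.norm_of_nonneg (Real.rpow_nonneg e1.le _), ← Real.mul_rpow (by norm_num) e1.le]
      exact Real.rpow_le_rpow_of_nonpos (by positivity) e2 (by linarith))
    (hint.norm.const_mul _)
    (by
      filter_upwards [ae_P_lt hd] with k hk
      refine Tendsto.const_mul _ ?_
      have : ContinuousAt (fun r : ℝ => (1 - r * ((∑ j, Real.cos (k j)) / d)) ^ (-b)) 1 := by
        refine ContinuousAt.rpow_const (by fun_prop) (Or.inl ?_)
        rw [one_mul]
        linarith
      have h2 := this.tendsto.mono_left (nhdsWithin_le_nhds (s := Set.Iio 1))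
      simpa only [one_mul] using h2)
  refine ge_of_tendsto ht ?_
  filter_upwards [hev] with r hr
  exact reg_nonneg n hb hr.1 hr.2

lemma Riesz_nonneg (hd : 0 < d) {α : ℝ} (hα : 0 < α) (x y : Z d) : 0 ≤ Riesz d α x y := by
  unfold Riesz
  have hK : 0 ≤ Kfrac d α := by
    unfold Kfrac
    exact mul_nonneg (by positivity) (integral_nonneg fun k => Real.rpow_nonneg (muk_nonneg k) _)
  refine mul_nonneg (mul_nonneg hK (by positivity)) ?_
  have hd' : (0 : ℝ) < d := by exact_mod_cast hd
  have h : ∀ k : Fin d → ℝ, Real.cos (∑ j, ((x j - y j : ℤ) : ℝ) * k j) * muk d k ^ (-(α / 2)) =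
      (2 * (d : ℝ)) ^ (-(α / 2)) * (Real.cos (∑ j, ((x j - y j : ℤ) : ℝ) * k j) *
        (1 - (∑ j, Real.cos (k j)) / d) ^ (-(α / 2))) := by
    intro k
    have hP := abs_le.1 (P_le k)
    have : muk d k = (2 * (d : ℝ)) * (1 - (∑ j, Real.cos (k j)) / d) := by
      unfold muk
      field_simp
    rw [this, Real.mul_rpow (by positivity) (by linarith)]
    ring
  simp_rw [h]
  rw [integral_const_mul]
  exact mul_nonneg (by positivity) (lim_nonneg hd (fun j => x j - y j) (by positivity))

theorem energy_positive_on_nehari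
    {d : ℕ} (hd : 0 < d) {s p : ℝ} (hs : s ∈ Set.Ioo (0 : ℝ) 1) (hp : 2 ≤ p)
    {W : Z d → Z d → ℝ} (hW : KernelOK d s W)
    {α : ℝ} (hα : α ∈ Set.Ioo (0 : ℝ) (d : ℝ))
    {h : Z d → ℝ} {h₀ : ℝ} (hh₀ : 0 < h₀) (hh1 : ∀ x, h₀ ≤ h x)
    {f : ℝ → ℝ} (hfc : Continuous f) (hfz : ∀ t ≤ (0 : ℝ), f t = 0)
    (hf1 : F1 f p)
    {C₀ τ : ℝ} (hC₀ : 0 < C₀) (hτ : ((d : ℝ) + α) * p / (2 * d) < τ)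
    (hf2 : ∀ t > (0 : ℝ), f t ≤ C₀ * (1 + t ^ (τ - 1)))
    {θ : ℝ} (hθ : p < θ) (hf3 : F3 f θ)
 :
    ∀ u ∈ Nehari W h p α f,
      (1 / p - 1 / θ) * HnormP W h p u ≤ energy W h p α f u ∧
        0 < (1 / p - 1 / θ) * HnormP W h p u := by
  intro u hu
  obtain ⟨⟨hmem1, hmem2⟩, hu0, hN⟩ := hu
  have hp0 : 0 < p := by linarith
  have hθ0 : 0 < θ := by linarith
  have hterm : ∀ x, 0 ≤ gradNorm W u x ^ p + h x * |u x| ^ p := fun x =>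
    add_nonneg (Real.rpow_nonneg (Real.sqrt_nonneg _) _)
      (mul_nonneg (hh₀.le.trans (hh1 x)) (Real.rpow_nonneg (abs_nonneg _) _))
  have hHpos : 0 < HnormP W h p u := by
    obtain ⟨x, hx⟩ := Function.ne_iff.1 hu0
    refine hmem2.tsum_pos hterm x ?_
    have h1 : 0 < |u x| := abs_pos.2 hx
    exact add_pos_of_nonneg_of_pos (Real.rpow_nonneg (Real.sqrt_nonneg _) _)
      (mul_pos (hh₀.trans_le (hh1 x)) (Real.rpow_pos_of_pos h1 _))
  have hcoef : 0 < 1 / p - 1 / θ := sub_pos.2 (one_div_lt_one_div_of_lt hp0 hθ)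
  refine ⟨?_, mul_pos hcoef hHpos⟩
  have hF : ∀ x, 0 ≤ Fint f (pos u x) ∧ θ * Fint f (pos u x) ≤ 2 * (f (pos u x) * pos u x) := by
    intro x
    have hpx : 0 ≤ pos u x := le_max_right (u x) 0
    rcases hpx.eq_or_lt with h0 | h0
    · rw [← h0]
      simp [Fint]
    · obtain ⟨h1, h2⟩ := hf3 _ h0
      exact ⟨nonneg_of_mul_nonneg_right h1 hθ0, by linarith⟩
  have hconv : ∀ x, 0 ≤ conv d α (fun y => Fint f (pos u y)) x := fun x =>
    tsum_nonneg fun y => mul_nonneg (Riesz_nonneg hd hα.1 x y) (hF y).1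
  have hsum : Summable fun x : Z d =>
      conv d α (fun y => Fint f (pos u y)) x * f (pos u x) * pos u x := by
    by_contra hns
    rw [tsum_eq_zero_of_not_summable hns] at hN
    linarith
  have hle : ∀ x, conv d α (fun y => Fint f (pos u y)) x * Fint f (pos u x) ≤
      2 / θ * (conv d α (fun y => Fint f (pos u y)) x * f (pos u x) * pos u x) := by
    intro x
    have h1 : Fint f (pos u x) ≤ 2 / θ * (f (pos u x) * pos u x) := by
      rw [div_mul_eq_mul_div, le_div_iff₀ hθ0]
      linarith [(hF x).2]
    calc _ ≤ conv d α (fun y => Fint f (pos u y)) x * (2 / θ * (f (pos u x) * pos u x)) :=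
          mul_le_mul_of_nonneg_left h1 (hconv x)
      _ = _ := by ring
  have hsum2 := Summable.of_nonneg_of_le
    (fun x => mul_nonneg (hconv x) (hF x).1) hle (hsum.mul_left _)
  have hfin := hsum2.tsum_le_tsum hle (hsum.mul_left _)
  rw [tsum_mul_left, ← hN] at hfin
  unfold energy
  have e : (1 / 2) * (2 / θ * HnormP W h p u) = 1 / θ * HnormP W h p u := by ring
  linarith

end DiscreteChoquard
end
end
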